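/- Let q ∈ (0,1), s ∈ (−1,0), n ≥ 1, and let u₁,…,u_n be pairwise distinct positive reals with u_i ≠ q·u_j for all i, j. Fix r > q^{−1}, an integer ℓ ≥ 1, and x ∈ ℤ≥1. Then there exist δ₀, ρ₀ > 0 such that for all δ ∈ (0,δ₀) and ρ ∈ (0,ρ₀): Σ_{ν ∈ Sign⁺_n} M_{u;ρ}(ν) · q^{ℓ·h_ν(x)} = q^{ℓ(ℓ−1)/2} · (2πi)^{−ℓ} ∮_{γ[ū|1]} ⋯ ∮_{γ[ū|ℓ]} ∏_{1≤α<β≤ℓ} (w_α−w_β)/(w_α−qw_β) · ∏_{i=1}^ℓ [ w_i^{−1} · ((1−s w_i)/(1−s^{−1} w_i))^{x−1} · ∏_{j=1}^n (1−q u_j w_i)/(1−u_j w_i) ] dw₁⋯dw_ℓ, where the series on the left converges absolutely, γ[ū|j] is the union of the positively oriented circles of radius δ centered at u₁^{−1},…,u_n^{−1} together with the positively oriented circle of radius r^j·ρ centered at 0 (the variable w_j is integrated over γ[ū|j], and an integral over a union of circles means the sum of the corresponding circle integrals). -/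

import Mathlib

open Finset

noncomputable section

/-- The finite q-Pochhammer symbol `(a;q)_m = ∏_{i=0}^{m-1} (1 - a q^i)`. -/
def qPoch {K : Type*} [CommRing K] (a q : K) (m : ℕ) : K :=
  ∏ i ∈ Finset.range m, (1 - a * q ^ i)

/-- Signatures of length `n`: weakly decreasing tuples of nonnegative integers. -/
abbrev Sign (n : ℕ) : Type :=
  {ν : Fin n → ℕ // ∀ i j : Fin n, i ≤ j → ν j ≤ ν i}

/-- The symmetric rational function `F_μ(u₁,…,u_M)` (symmetrization formula (4.20)). -/
def Ffun (q s : ℂ) {M : ℕ} (μ : Fin M → ℕ) (u : Fin M → ℂ) : ℂ :=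
  ((1 - q) ^ M / ∏ i, (1 - s * u i)) *
    ∑ σ : Equiv.Perm (Fin M),
      (∏ p ∈ (Finset.univ : Finset (Fin M × Fin M)).filter (fun p => p.1 < p.2),
        (u (σ p.1) - q * u (σ p.2)) / (u (σ p.1) - u (σ p.2))) *
      ∏ i, ((u (σ i) - s) / (1 - s * u (σ i))) ^ (μ i)

/-- Multiplicity of the value `k` among the parts of `lam`. -/
def mult {n : ℕ} (lam : Fin n → ℕ) (k : ℕ) : ℕ :=
  ((Finset.univ : Finset (Fin n)).filter (fun i => lam i = k)).card

/-- The conjugation constant `c(λ) = ∏_{k≥0} (s²;q)_{m_k}/(q;q)_{m_k}`. -/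
def cconst (q s : ℂ) {n : ℕ} (lam : Fin n → ℕ) : ℂ :=
  ∏ᶠ k : ℕ, qPoch (s ^ 2) q (mult lam k) / qPoch q q (mult lam k)

/-- `F^c_λ = c(λ)·F_λ`. -/
def Fc (q s : ℂ) {M : ℕ} (μ : Fin M → ℕ) (u : Fin M → ℂ) : ℂ :=
  cconst q s μ * Ffun q s μ u

/-- The symmetric rational function `G_ν(v₁,…,v_N)` (symmetrization formula (4.21)). -/
def Gfun (q s : ℂ) {n N : ℕ} (ν : Fin n → ℕ) (v : Fin N → ℂ) : ℂ :=
  if h : n - mult ν 0 ≤ N then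
    (qPoch (s ^ 2) q n / (qPoch q q (N - (n - mult ν 0)) * qPoch (s ^ 2) q (mult ν 0))) *
      ((1 - q) ^ N / ∏ j, (1 - s * v j)) *
      ∑ σ : Equiv.Perm (Fin N),
        (∏ p ∈ (Finset.univ : Finset (Fin N × Fin N)).filter (fun p => p.1 < p.2),
          (v (σ p.1) - q * v (σ p.2)) / (v (σ p.1) - v (σ p.2))) *
        (∏ j : Fin (n - mult ν 0),
          ((v (σ (Fin.castLE h j)) - s) / (1 - s * v (σ (Fin.castLE h j)))) ^
            (ν (Fin.castLE (Nat.sub_le n (mult ν 0)) j))) *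
        (∏ i : Fin (n - mult ν 0), v (σ (Fin.castLE h i)) / (v (σ (Fin.castLE h i)) - s)) *
        (∏ j ∈ (Finset.univ : Finset (Fin N)).filter (fun j : Fin N => n - mult ν 0 ≤ (j : ℕ)),
          (1 - s * q ^ (mult ν 0) * v (σ j)))
  else 0

/-- Iterated integral: `iterInt k ops f` applies the integration functional `ops i` to the
`i`-th variable (outermost first). -/
def iterInt : (k : ℕ) → (Fin k → ((ℂ → ℂ) → ℂ)) → ((Fin k → ℂ) → ℂ) → ℂ
  | 0, _, f => f Fin.elim0
  | k + 1, ops, f => ops 0 (fun z => iterInt k (fun i => ops i.succ) (fun u => f (Fin.cons z u)))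

/-- The weight `M_{u;ρ}(ν) = 1_{ν_n ≥ 1}·(−s)^{|ν|−n}·F^c_{ν−1^n}(u)` of the stochastic higher
spin six vertex model at time `n`, started from the empty configuration. -/
def Mwt (q s : ℂ) {n : ℕ} (u : Fin n → ℂ) (ν : Fin n → ℕ) : ℂ :=
  (if ∀ i, 1 ≤ ν i then (1 : ℂ) else 0) * (-s) ^ (∑ i, ν i - n) *
    Fc q s (fun i => ν i - 1) u

/-- The height function `h_ν(x) = #{j : ν_j ≥ x}`. -/
def height {n : ℕ} (ν : Fin n → ℕ) (x : ℕ) : ℕ :=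
  ((Finset.univ : Finset (Fin n)).filter (fun j => x ≤ ν j)).card

/-- The two-body factor `(u_a - q u_b) / (u_a - u_b)`. -/
def pairFactor {ι : Type*} (q : ℂ) (u : ι → ℂ) (a b : ι) : ℂ :=
  (u a - q * u b) / (u a - u b)

/-- The product of the two-body factors over `A × B`. -/
def crossFactor {ι : Type*} (q : ℂ) (u : ι → ℂ) (A B : Finset ι) : ℂ :=
  ∏ a ∈ A, ∏ b ∈ B, pairFactor q u a b

section Algebra

variable {ι : Type*} [DecidableEq ι]

theorem sum_prod_pairFactor (q : ℂ) (u : ι → ℂ) (hu : Function.Injective u) (h0 : ∀ a, u a ≠ 0)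
    (A : Finset ι) :
    (1 - q) * ∑ a ∈ A, ∏ b ∈ A.erase a, pairFactor q u a b = 1 - q ^ #A := by
  classical
  let v : Option ι → ℂ := fun o => o.elim 0 u
  have hv : Set.InjOn v (insertNone A : Finset (Option ι)) := by
    rintro (_ | a) _ (_ | b) _ h
    · rfl
    · exact absurd h.symm (h0 b)
    · exact absurd h (h0 a)
    · exact congrArg _ (hu h)
  let P : Polynomial ℂ := Lagrange.nodal A (fun b => q * u b)
  have hP : P.degree < #(insertNone A) := by
    rw [Lagrange.degree_nodal, card_insertNone]
    exact_mod_cast Nat.lt_succ_self _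
  have key := Lagrange.coeff_eq_sum hv hP
  have hc : P.coeff (#(insertNone A) - 1) = 1 := by
    have h1 : P.Monic := Lagrange.nodal_monic
    have h2 : P.natDegree = #A := Lagrange.natDegree_nodal
    rw [card_insertNone, Nat.add_sub_cancel, ← h2]
    exact h1.coeff_natDegree
  rw [hc, sum_insertNone] at key
  have hn : (insertNone A).erase none = A.map Function.Embedding.some := by
    ext (_ | a) <;> simp
  have hs : ∀ a, (insertNone A).erase (some a) = insertNone (A.erase a) := by
    intro a
    ext (_ | b) <;> simp
  have t0 : Polynomial.eval (v none) P / ∏ j ∈ (insertNone A).erase none, (v none - v j)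
      = q ^ #A := by
    rw [hn, prod_map, Lagrange.eval_nodal, ← prod_div_distrib, ← prod_const]
    refine prod_congr rfl fun b _ => ?_
    have := h0 b
    simp only [v, Option.elim, Function.Embedding.some_apply]
    field_simp
    ring
  have t1 : ∀ a ∈ A, Polynomial.eval (v (some a)) P /
      ∏ j ∈ (insertNone A).erase (some a), (v (some a) - v j)
      = (1 - q) * ∏ b ∈ A.erase a, pairFactor q u a b := by
    intro a ha
    rw [hs, prod_insertNone, Lagrange.eval_nodal, ← mul_prod_erase _ _ ha]
    simp only [v, Option.elim, pairFactor, prod_div_distrib]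
    have := h0 a
    field_simp
    ring
  rw [t0, sum_congr rfl t1, ← mul_sum] at key
  linear_combination -key

theorem crossFactor_insert_left (q : ℂ) (u : ι → ℂ) {c : ι} {A : Finset ι} (B : Finset ι)
    (hc : c ∉ A) :
    crossFactor q u (insert c A) B = (∏ b ∈ B, pairFactor q u c b) * crossFactor q u A B := by
  rw [crossFactor, prod_insert hc, crossFactor]

theorem crossFactor_insert_right (q : ℂ) (u : ι → ℂ) {c : ι} (A : Finset ι) {B : Finset ι}
    (hc : c ∉ B) :
    crossFactor q u A (insert c B) = (∏ a ∈ A, pairFactor q u a c) * crossFactor q u A B := by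
  simp only [crossFactor, prod_insert hc, prod_mul_distrib]

/-- A sum over splittings `A = J ⊔ K` that does not depend on `t`. -/
theorem sum_powerset_crossFactor (q : ℂ) (z : ι → ℂ) (hz : Function.Injective z)
    (h1 : ∀ a, z a ≠ 1) (A : Finset ι) (t : ℂ) :
    ∑ J ∈ A.powerset, (∏ a ∈ J, (t - z a)) * crossFactor q z J (A \ J) *
      qPoch t q #(A \ J) = ∏ a ∈ A, (1 - z a) := by
  classical
  induction A using Finset.strongInduction generalizing t with
  | H A ih =>
  let P : Polynomial ℂ := ∑ J ∈ A.powerset, (∏ a ∈ J, (Polynomial.X - Polynomial.C (z a))) *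
    Polynomial.C (crossFactor q z J (A \ J)) *
      ∏ i ∈ range #(A \ J), (1 - Polynomial.X * Polynomial.C (q ^ i))
  have hev : ∀ t, P.eval t = ∑ J ∈ A.powerset, (∏ a ∈ J, (t - z a)) *
      crossFactor q z J (A \ J) * qPoch t q #(A \ J) := by
    intro t
    simp [P, Polynomial.eval_finsetSum, Polynomial.eval_prod, qPoch]
  rw [← hev]
  have hdeg : P.natDegree ≤ #A := by
    refine Polynomial.natDegree_sum_le_of_forall_le _ _ fun J hJ => ?_
    have hJ' := mem_powerset.1 hJ
    refine Polynomial.natDegree_mul_le.trans ?_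
    have e1 : (∏ a ∈ J, (Polynomial.X - Polynomial.C (z a))).natDegree ≤ #J := by
      refine (Polynomial.natDegree_prod_le _ _).trans ?_
      simp
    have e2 : (∏ i ∈ range #(A \ J), (1 - Polynomial.X * Polynomial.C (q ^ i))).natDegree
        ≤ #(A \ J) := by
      refine (Polynomial.natDegree_prod_le _ _).trans ?_
      refine (sum_le_card_nsmul _ _ 1 fun i _ => ?_).trans (by simp)
      compute_degree
    have e3 := Polynomial.natDegree_mul_C_le (∏ a ∈ J, (Polynomial.X - Polynomial.C (z a)))
      (crossFactor q z J (A \ J))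
    have := card_sdiff_add_card_eq_card hJ'
    omega
  suffices h : P = Polynomial.C (∏ a ∈ A, (1 - z a)) by rw [h, Polynomial.eval_C]
  have hone : (1 : ℂ) ∉ A.image z := by
    simp only [mem_image, not_exists, not_and]
    exact fun a _ => h1 a
  refine Polynomial.eq_of_degree_sub_lt_of_eval_finset_eq (insert 1 (A.image z)) ?_ ?_
  · rw [card_insert_of_notMem hone, card_image_of_injective _ hz]
    refine lt_of_le_of_lt (Polynomial.degree_sub_le _ _) (max_lt ?_ ?_)
    · exact lt_of_le_of_lt (Polynomial.degree_le_of_natDegree_le hdeg)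
        (by exact_mod_cast Nat.lt_succ_self _)
    · exact lt_of_le_of_lt Polynomial.degree_C_le (by exact_mod_cast Nat.succ_pos _)
  · intro x hx
    rw [Polynomial.eval_C, hev]
    rcases mem_insert.1 hx with rfl | hx
    · rw [sum_eq_single A]
      · simp [crossFactor, qPoch]
      · intro J hJ hne
        have : 0 < #(A \ J) := card_pos.2 <| sdiff_nonempty.2 fun h =>
          hne (subset_antisymm (mem_powerset.1 hJ) h)
        rw [qPoch, prod_eq_zero (mem_range.2 this) (by simp), mul_zero]
      · simp
    · obtain ⟨c, hc, rfl⟩ := mem_image.1 hx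
      have hcc : c ∉ A.erase c := by simp
      have hA : A = insert c (A.erase c) := (insert_erase hc).symm
      have hrec := ih _ (erase_ssubset hc) (q * z c)
      rw [← mul_prod_erase _ _ hc, ← hrec, mul_sum]
      conv_lhs => rw [hA]
      rw [sum_powerset_insert hcc]
      rw [add_eq_left.2]
      · refine sum_congr rfl fun J hJ => ?_
        have hJ' := mem_powerset.1 hJ
        have hcJ : c ∉ J := fun h => hcc (hJ' h)
        have hs : insert c (A.erase c) \ J = insert c (A.erase c \ J) :=
          insert_sdiff_of_notMem _ hcJ
        have hcK : c ∉ A.erase c \ J := fun h => hcc (mem_sdiff.1 h).1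
        rw [hs, crossFactor_insert_right _ _ _ hcK, card_insert_of_notMem hcK, qPoch,
          prod_range_succ', qPoch]
        have e1 : (∏ a ∈ J, (z c - z a)) * ∏ a ∈ J, pairFactor q z a c
            = ∏ a ∈ J, (q * z c - z a) := by
          rw [← prod_mul_distrib]
          refine prod_congr rfl fun a ha => ?_
          have : z a - z c ≠ 0 := sub_ne_zero.2 fun h => hcJ (hz h ▸ ha)
          rw [pairFactor]
          field_simp
          ring
        have e2 : ∏ i ∈ range #(A.erase c \ J), (1 - z c * q ^ (i + 1))
            = ∏ i ∈ range #(A.erase c \ J), (1 - q * z c * q ^ i) :=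
          prod_congr rfl fun i _ => by ring
        rw [← e1, e2]
        ring
      · refine sum_eq_zero fun J _ => ?_
        rw [prod_eq_zero (mem_insert_self c J) (sub_self _), zero_mul, zero_mul]

end Algebra

section Configurations

theorem summable_prod_pow {n : ℕ} (r : Fin n → ℝ) (h0 : ∀ a, 0 ≤ r a) (h1 : ∀ a, r a < 1) :
    Summable fun κ : Fin n → ℕ => ∏ a, r a ^ κ a := by
  induction n with
  | zero => exact (hasSum_fintype _).summable
  | succ n ih =>
    rw [← (Fin.consEquiv fun _ : Fin (n + 1) => ℕ).summable_iff]
    have h := (summable_geometric_of_lt_one (h0 0) (h1 0)).mul_of_nonneg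
      (ih (fun a => r a.succ) (fun a => h0 _) fun a => h1 _)
      (fun k => pow_nonneg (h0 0) k) (fun κ => prod_nonneg fun a _ => pow_nonneg (h0 _) _)
    refine h.congr fun p => ?_
    simp [Fin.consEquiv, Fin.prod_univ_succ]

variable {n : ℕ}

/-- Configurations `κ` supported on `A`. -/
abbrev Supported (A : Finset (Fin n)) : Type := {κ : Fin n → ℕ // ∀ a, a ∉ A → κ a = 0}

/-- The weight of an unsorted particle configuration `κ` on the labels `A`. -/
def cfgWeight (q t : ℂ) (u φ d : Fin n → ℂ) (A : Finset (Fin n)) (κ : Fin n → ℕ) : ℂ :=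
  ∏ a ∈ A, (φ a ^ κ a * (d a * (1 - t * q ^ #{b ∈ A | b < a ∧ κ b = κ a})) *
    ∏ b ∈ A with κ b < κ a, pairFactor q u a b)

/-- The total weight of configurations supported on `A`. -/
def totalWeight (q t : ℂ) (u φ d : Fin n → ℂ) (A : Finset (Fin n)) : ℂ :=
  ∑' κ : Supported A, cfgWeight q t u φ d A κ

/-- The weight of configurations supported on `A` with all positions below `y`. -/
def lowWeight (q t : ℂ) (u φ d : Fin n → ℂ) (y : ℕ) (A : Finset (Fin n)) : ℂ :=
  ∑' κ : Supported A, if ∀ a ∈ A, κ.1 a < y then cfgWeight q t u φ d A κ else 0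

/-- The generating function of the number of particles at or above `y`. -/
def heightGen (q t : ℂ) (u φ d : Fin n → ℂ) (y : ℕ) (Q : ℂ) (A : Finset (Fin n)) : ℂ :=
  ∑' κ : Supported A, cfgWeight q t u φ d A κ * Q ^ #{a ∈ A | y ≤ κ.1 a}

theorem summable_cfgWeight_mul {q t : ℂ} (hq : ‖q‖ ≤ 1) (u : Fin n → ℂ) {φ : Fin n → ℂ}
    (hφ : ∀ a, ‖φ a‖ < 1) (d : Fin n → ℂ) (A : Finset (Fin n)) (c : Supported A → ℂ)
    (hc : ∀ κ, ‖c κ‖ ≤ 1) :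
    Summable fun κ : Supported A => ‖cfgWeight q t u φ d A κ * c κ‖ := by
  have hs : Summable fun κ : Supported A => ∏ a, ‖φ a‖ ^ κ.1 a :=
    (summable_prod_pow (fun a => ‖φ a‖) (fun a => norm_nonneg _) hφ).comp_injective
      Subtype.val_injective
  refine Summable.of_nonneg_of_le (fun κ => norm_nonneg _) (fun κ => ?_)
    (hs.mul_left (∏ a ∈ A, ((‖d a‖ * (1 + ‖t‖)) * ∏ b ∈ A, max 1 ‖pairFactor q u a b‖)))
  have h1 : ∏ a, ‖φ a‖ ^ κ.1 a = ∏ a ∈ A, ‖φ a‖ ^ κ.1 a := by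
    refine (prod_subset (subset_univ A) fun a _ ha => ?_).symm
    rw [κ.2 a ha, pow_zero]
  rw [norm_mul, h1, ← prod_mul_distrib]
  refine (mul_le_of_le_one_right (norm_nonneg _) (hc κ)).trans ?_
  rw [cfgWeight, norm_prod]
  refine prod_le_prod (fun a _ => norm_nonneg _) fun a _ => ?_
  rw [norm_mul, norm_mul, norm_mul, norm_pow, norm_prod]
  have h2 : ‖1 - t * q ^ #{b ∈ A | b < a ∧ κ.1 b = κ.1 a}‖ ≤ 1 + ‖t‖ := by
    refine (norm_sub_le _ _).trans ?_
    rw [norm_one, norm_mul, norm_pow]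
    gcongr
    exact mul_le_of_le_one_right (norm_nonneg _) (pow_le_one₀ (norm_nonneg _) hq)
  have h3 : ∏ b ∈ A with κ.1 b < κ.1 a, ‖pairFactor q u a b‖
      ≤ ∏ b ∈ A, max 1 ‖pairFactor q u a b‖ := by
    rw [prod_filter]
    refine prod_le_prod (fun b _ => ?_) fun b _ => ?_
    · split_ifs <;> positivity
    · split_ifs
      · exact le_max_right _ _
      · exact le_max_left _ _
  calc _ ≤ ‖φ a‖ ^ κ.1 a * (‖d a‖ * (1 + ‖t‖)) * ∏ b ∈ A, max 1 ‖pairFactor q u a b‖ := by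
        gcongr
    _ = _ := by ring

/-- Glue a configuration on `J`, raised by `y`, to a configuration on `A \ J`. -/
def glue (y : ℕ) {A J : Finset (Fin n)} (hJ : J ⊆ A) (p : Supported J × Supported (A \ J)) :
    Supported A :=
  ⟨fun a => if a ∈ J then p.1.1 a + y else p.2.1 a, fun a ha => by
    beta_reduce
    rw [if_neg fun h => ha (hJ h)]
    exact p.2.2 a fun h => ha (mem_sdiff.1 h).1⟩

theorem glue_injective (y : ℕ) {A J : Finset (Fin n)} (hJ : J ⊆ A) :
    Function.Injective (glue y hJ) := by
  rintro ⟨⟨f, hf⟩, ⟨g, hg⟩⟩ ⟨⟨f', hf'⟩, ⟨g', hg'⟩⟩ h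
  have h' : ∀ a, (if a ∈ J then f a + y else g a) = if a ∈ J then f' a + y else g' a :=
    fun a => congrFun (congrArg Subtype.val h) a
  simp only [Prod.mk.injEq, Subtype.mk.injEq]
  constructor <;> funext a <;> by_cases ha : a ∈ J
  · simpa [ha] using h' a
  · rw [hf a ha, hf' a ha]
  · rw [hg a (by simp [ha]), hg' a (by simp [ha])]
  · simpa [ha] using h' a

theorem mem_range_glue (y : ℕ) {A J : Finset (Fin n)} (hJ : J ⊆ A) (κ : Supported A)
    (h : ∀ a ∈ J, y ≤ κ.1 a) : κ ∈ Set.range (glue y hJ) := by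
  refine ⟨⟨⟨fun a => if a ∈ J then κ.1 a - y else 0, fun a ha => if_neg ha⟩,
    ⟨fun a => if a ∈ J then 0 else κ.1 a, fun a ha => ?_⟩⟩, ?_⟩
  · by_cases haJ : a ∈ J
    · simp [haJ]
    · beta_reduce
      rw [if_neg haJ]
      exact κ.2 a fun hA => ha (mem_sdiff.2 ⟨hA, haJ⟩)
  · refine Subtype.ext (funext fun a => ?_)
    by_cases haJ : a ∈ J
    · simp [glue, haJ, Nat.sub_add_cancel (h a haJ)]
    · simp [glue, haJ]

theorem cfgWeight_glue (q t : ℂ) (u φ d : Fin n → ℂ) (y : ℕ) {A J : Finset (Fin n)} (hJ : J ⊆ A)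
    (p : Supported J × Supported (A \ J)) (hp : ∀ a ∈ A \ J, p.2.1 a < y) :
    cfgWeight q t u φ d A (glue y hJ p) = (∏ a ∈ J, φ a ^ y) * crossFactor q u J (A \ J) *
      (cfgWeight q t u φ d J p.1 * cfgWeight q t u φ d (A \ J) p.2) := by
  have g1 : ∀ a ∈ J, (glue y hJ p).1 a = p.1.1 a + y := fun a ha => if_pos ha
  have g2 : ∀ a ∈ A \ J, (glue y hJ p).1 a = p.2.1 a := fun a ha => if_neg (mem_sdiff.1 ha).2
  generalize hκ : (glue y hJ p).1 = κ at g1 g2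
  rw [cfgWeight, ← prod_sdiff hJ, crossFactor, cfgWeight, cfgWeight, mul_comm (∏ a ∈ A \ J, _),
    ← mul_assoc, ← prod_mul_distrib, ← prod_mul_distrib]
  congr 1
  · refine prod_congr rfl fun a ha => ?_
    have e1 : {b ∈ A | b < a ∧ κ b = κ a} = {b ∈ J | b < a ∧ p.1.1 b = p.1.1 a} := by
      ext b
      simp only [mem_filter]
      by_cases hb : b ∈ J
      · rw [g1 b hb, g1 a ha]
        simp [hb, hJ hb]
      · simp only [hb, false_and, iff_false, not_and]
        intro hbA _
        have := hp b (mem_sdiff.2 ⟨hbA, hb⟩)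
        rw [g2 b (mem_sdiff.2 ⟨hbA, hb⟩), g1 a ha]
        omega
    have e2 : {b ∈ A | κ b < κ a} = {b ∈ J | p.1.1 b < p.1.1 a} ∪ (A \ J) := by
      ext b
      simp only [mem_filter, mem_union, mem_sdiff]
      by_cases hb : b ∈ J
      · rw [g1 b hb, g1 a ha]
        simp [hb, hJ hb]
      · simp only [hb, false_and, not_false_eq_true, and_true, false_or, and_iff_left_iff_imp]
        intro hbA
        have := hp b (mem_sdiff.2 ⟨hbA, hb⟩)
        rw [g2 b (mem_sdiff.2 ⟨hbA, hb⟩), g1 a ha]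
        omega
    have hd : Disjoint {b ∈ J | p.1.1 b < p.1.1 a} (A \ J) :=
      disjoint_sdiff.mono_left (filter_subset _ _)
    rw [e1, e2, prod_union hd, g1 a ha, pow_add]
    ring
  · refine prod_congr rfl fun a ha => ?_
    have e1 : {b ∈ A | b < a ∧ κ b = κ a} = {b ∈ A \ J | b < a ∧ p.2.1 b = p.2.1 a} := by
      ext b
      simp only [mem_filter, mem_sdiff]
      by_cases hb : b ∈ J
      · have := hp a ha
        rw [g1 b hb, g2 a ha]
        simp only [hb, not_true, and_false, false_and, iff_false, not_and]
        omega
      · simp only [hb, not_false_eq_true, and_true]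
        refine and_congr_right fun hbA => ?_
        rw [g2 b (mem_sdiff.2 ⟨hbA, hb⟩), g2 a ha]
    have e2 : {b ∈ A | κ b < κ a} = {b ∈ A \ J | p.2.1 b < p.2.1 a} := by
      ext b
      simp only [mem_filter, mem_sdiff]
      by_cases hb : b ∈ J
      · have := hp a ha
        rw [g1 b hb, g2 a ha]
        simp only [hb, not_true, and_false, false_and, iff_false, not_and]
        omega
      · simp only [hb, not_false_eq_true, and_true]
        refine and_congr_right fun hbA => ?_
        rw [g2 b (mem_sdiff.2 ⟨hbA, hb⟩), g2 a ha]
    rw [e1, e2, g2 a ha]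

theorem heightGen_eq_sum {q t : ℂ} (hq : ‖q‖ ≤ 1) (u : Fin n → ℂ) {φ : Fin n → ℂ}
    (hφ : ∀ a, ‖φ a‖ < 1) (d : Fin n → ℂ) (y : ℕ) (Q : ℂ) (A : Finset (Fin n)) :
    heightGen q t u φ d y Q A = ∑ J ∈ A.powerset, Q ^ #J * ((∏ a ∈ J, φ a ^ y) *
      crossFactor q u J (A \ J) * (totalWeight q t u φ d J * lowWeight q t u φ d y (A \ J))) := by
  have key : ∀ J ∈ A.powerset, HasSum (fun κ : Supported A => if {a ∈ A | y ≤ κ.1 a} = J then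
      cfgWeight q t u φ d A κ * Q ^ #{a ∈ A | y ≤ κ.1 a} else 0)
      (Q ^ #J * ((∏ a ∈ J, φ a ^ y) * crossFactor q u J (A \ J) *
        (totalWeight q t u φ d J * lowWeight q t u φ d y (A \ J)))) := by
    intro J hJ
    replace hJ := mem_powerset.1 hJ
    have s1 : Summable fun κ : Supported J => ‖cfgWeight q t u φ d J κ‖ := by
      simpa using summable_cfgWeight_mul (t := t) hq u hφ d J (fun _ => 1) (by simp)
    have s2 : Summable fun κ : Supported (A \ J) =>
        ‖if ∀ a ∈ A \ J, κ.1 a < y then cfgWeight q t u φ d (A \ J) κ else 0‖ := by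
      refine (summable_cfgWeight_mul (t := t) hq u hφ d (A \ J)
        (fun κ => if ∀ a ∈ A \ J, κ.1 a < y then 1 else 0) ?_).congr ?_
      · intro κ
        split_ifs <;> simp
      · intro κ
        split_ifs <;> simp
    have s1' : Summable fun κ : Supported J => cfgWeight q t u φ d J κ := s1.of_norm
    have s2' : Summable fun κ : Supported (A \ J) =>
        if ∀ a ∈ A \ J, κ.1 a < y then cfgWeight q t u φ d (A \ J) κ else 0 := s2.of_norm
    have s12 := summable_mul_of_summable_norm
      (f := fun κ : Supported J => cfgWeight q t u φ d J κ)
      (g := fun κ : Supported (A \ J) =>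
        if ∀ a ∈ A \ J, κ.1 a < y then cfgWeight q t u φ d (A \ J) κ else 0) s1 s2
    have h12 := (s1'.hasSum.mul s2'.hasSum s12).mul_left
      (Q ^ #J * ((∏ a ∈ J, φ a ^ y) * crossFactor q u J (A \ J)))
    rw [totalWeight, lowWeight, ← mul_assoc, ← (glue_injective y hJ).hasSum_iff]
    · refine h12.congr_fun ?_
      intro p
      have hl : {a ∈ A | y ≤ (glue y hJ p).1 a} = J ↔ ∀ a ∈ A \ J, p.2.1 a < y := by
        constructor
        · intro h a ha
          by_contra hlt
          have : a ∈ J := by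
            rw [← h, mem_filter]
            refine ⟨(mem_sdiff.1 ha).1, ?_⟩
            simpa [glue, (mem_sdiff.1 ha).2] using hlt
          exact (mem_sdiff.1 ha).2 this
        · intro h
          ext a
          simp only [mem_filter]
          by_cases ha : a ∈ J
          · simp [glue, ha, hJ ha]
          · simp only [ha, iff_false, not_and, not_le]
            intro hA
            simpa [glue, ha] using h a (mem_sdiff.2 ⟨hA, ha⟩)
      simp only [Function.comp_apply]
      by_cases hp : ∀ a ∈ A \ J, p.2.1 a < y
      · rw [if_pos (hl.2 hp), if_pos hp, cfgWeight_glue _ _ _ _ _ _ _ _ hp, hl.2 hp]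
        ring
      · rw [if_neg fun h => hp (hl.1 h), if_neg hp]
        simp
    · intro κ hκ
      refine if_neg fun h => hκ (mem_range_glue y hJ κ fun a ha => ?_)
      rw [← h] at ha
      exact (mem_filter.1 ha).2
  have h := hasSum_sum key
  rw [heightGen]
  refine HasSum.tsum_eq (h.congr_fun fun κ => ?_)
  rw [sum_ite_eq, if_pos (mem_powerset.2 (filter_subset _ _))]

end Configurations

section Moments

theorem prod_rank {ι M : Type*} [LinearOrder ι] [CommMonoid M] (g : ℕ → M) (A : Finset ι) :
    ∏ a ∈ A, g #{b ∈ A | b < a} = ∏ i ∈ range #A, g i := by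
  induction A using Finset.induction_on_max with
  | empty => simp
  | insert c A hc ih =>
    have hcA : c ∉ A := fun h => lt_irrefl c (hc c h)
    rw [prod_insert hcA, card_insert_of_notMem hcA, prod_range_succ, ← ih, mul_comm]
    congr 1
    · refine prod_congr rfl fun a ha => ?_
      rw [filter_insert, if_neg (hc a ha).not_gt]
    · rw [filter_insert, if_neg (lt_irrefl c), filter_true_of_mem hc]

variable {n : ℕ}

theorem lowWeight_one (q t : ℂ) (u φ d : Fin n → ℂ) (A : Finset (Fin n)) :
    lowWeight q t u φ d 1 A = (∏ a ∈ A, d a) * qPoch t q #A := by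
  rw [lowWeight, tsum_eq_single ⟨fun _ => 0, fun _ _ => rfl⟩]
  · simp [cfgWeight, prod_mul_distrib, qPoch, prod_rank fun i => 1 - t * q ^ i]
  · intro κ hκ
    refine if_neg fun h => hκ (Subtype.ext (funext fun a => ?_))
    by_cases ha : a ∈ A
    · exact Nat.lt_one_iff.1 (h a ha)
    · exact κ.2 a ha

/-- The single-particle hopping ratio in the variable `z = s u`, `t = s ^ 2`. -/
def hop (t : ℂ) (z : Fin n → ℂ) (a : Fin n) : ℂ := (t - z a) / (1 - z a)

theorem totalWeight_eq_one {q t : ℂ} (hq : ‖q‖ ≤ 1) {z : Fin n → ℂ} (hz : Function.Injective z)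
    (h1 : ∀ a, z a ≠ 1) (hφ : ∀ a, ‖hop t z a‖ < 1) (A : Finset (Fin n)) :
    totalWeight q t z (hop t z) (fun a => (1 - z a)⁻¹) A = 1 := by
  induction A using Finset.strongInduction with
  | H A ih =>
  set T := totalWeight q t z (hop t z) (fun a => (1 - z a)⁻¹) with hT
  rcases A.eq_empty_or_nonempty with rfl | hA
  · rw [hT, totalWeight, tsum_eq_single ⟨fun _ => 0, fun _ _ => rfl⟩]
    · simp [cfgWeight]
    · exact fun κ hκ => absurd (Subtype.ext (funext fun a => κ.2 a (notMem_empty a))) hκ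
  have hsum := heightGen_eq_sum (t := t) hq z hφ (fun a => (1 - z a)⁻¹) 1 1 A
  have hE : heightGen q t z (hop t z) (fun a => (1 - z a)⁻¹) 1 1 A = T A := by
    simp [heightGen, hT, totalWeight]
  rw [hE] at hsum
  simp only [one_pow, one_mul, pow_one, lowWeight_one, ← hT] at hsum
  have hid : ∑ J ∈ A.powerset, (∏ a ∈ J, hop t z a) * crossFactor q z J (A \ J) *
      ((∏ a ∈ A \ J, (1 - z a)⁻¹) * qPoch t q #(A \ J)) = 1 := by
    have hne : ∏ a ∈ A, (1 - z a) ≠ 0 :=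
      prod_ne_zero_iff.2 fun a _ => sub_ne_zero.2 (h1 a).symm
    have hD := sum_powerset_crossFactor q z hz h1 A t
    rw [← div_eq_one_iff_eq hne, sum_div] at hD
    refine (sum_congr rfl fun J hJ => ?_).trans hD
    rw [← prod_sdiff (mem_powerset.1 hJ)]
    simp only [hop, prod_div_distrib, prod_inv_distrib]
    ring
  have hdiff : T A - 1 = (∏ a ∈ A, hop t z a) * (T A - 1) := by
    have hsub := congrArg₂ (· - ·) hsum hid.symm
    beta_reduce at hsub
    rw [← sum_sub_distrib, sum_eq_single A] at hsub
    · refine hsub.trans ?_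
      simp [crossFactor, qPoch]
      ring
    · intro J hJ hne
      rw [ih J ((mem_powerset.1 hJ).ssubset_of_ne hne)]
      ring
    · simp
  have hlt : ‖∏ a ∈ A, hop t z a‖ < 1 := by
    rw [norm_prod]
    obtain ⟨a, ha⟩ := hA
    rw [← mul_prod_erase _ _ ha]
    exact mul_lt_one_of_nonneg_of_lt_one_left (norm_nonneg _) (hφ a)
      (prod_le_one (fun _ _ => norm_nonneg _) fun b _ => (hφ b).le)
  have hne : 1 - ∏ a ∈ A, hop t z a ≠ 0 := fun h => by
    rw [← sub_eq_zero.1 h, norm_one] at hlt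
    exact lt_irrefl _ hlt
  have : (1 - ∏ a ∈ A, hop t z a) * (T A - 1) = 0 := by linear_combination hdiff
  exact sub_eq_zero.1 ((mul_eq_zero.1 this).resolve_left hne)

theorem heightGen_one {q t : ℂ} (hq : ‖q‖ ≤ 1) {z : Fin n → ℂ} (hz : Function.Injective z)
    (h1 : ∀ a, z a ≠ 1) (hφ : ∀ a, ‖hop t z a‖ < 1) (y : ℕ) (A : Finset (Fin n)) :
    heightGen q t z (hop t z) (fun a => (1 - z a)⁻¹) y 1 A = 1 := by
  refine Eq.trans ?_ (totalWeight_eq_one hq hz h1 hφ A)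
  simp [heightGen, totalWeight]

theorem sum_mul_splitting_erase {q : ℂ} (z : Fin n → ℂ) (hz : Function.Injective z)
    (h0 : ∀ a, z a ≠ 0) (f : Fin n → ℂ) (P : Finset (Fin n) → ℂ) (Q : ℂ) (A : Finset (Fin n)) :
    Q * (1 - q) * ∑ a ∈ A, f a * (∏ b ∈ A.erase a, pairFactor q z a b) *
        ∑ J ∈ (A.erase a).powerset, Q ^ #J * ((∏ a ∈ J, f a) *
          crossFactor q z J (A.erase a \ J) * P (A.erase a \ J)) =
      ∑ J ∈ A.powerset, Q ^ #J * (1 - q ^ #J) * ((∏ a ∈ J, f a) *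
          crossFactor q z J (A \ J) * P (A \ J)) := by
  simp only [mul_sum]
  have : ∀ J ∈ A.powerset, Q ^ #J * (1 - q ^ #J) * ((∏ a ∈ J, f a) *
      crossFactor q z J (A \ J) * P (A \ J)) = ∑ a ∈ J, Q ^ #J * ((∏ a ∈ J, f a) *
      crossFactor q z J (A \ J) * P (A \ J)) * ((1 - q) * ∏ b ∈ J.erase a, pairFactor q z a b) := by
    intro J _
    rw [← mul_sum, ← mul_sum, sum_prod_pairFactor q z hz h0]
    ring
  rw [sum_congr rfl this, sum_sigma', sum_sigma']
  refine sum_bij' (fun p _ => ⟨insert p.1 p.2, p.1⟩) (fun p _ => ⟨p.2, p.1.erase p.2⟩) ?_ ?_ ?_ ?_ ?_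
  · rintro ⟨a, J⟩ h
    simp only [mem_sigma, mem_powerset] at h ⊢
    exact ⟨insert_subset h.1 (h.2.trans (erase_subset _ _)), mem_insert_self _ _⟩
  · rintro ⟨J, a⟩ h
    simp only [mem_sigma, mem_powerset] at h ⊢
    exact ⟨h.1 h.2, erase_subset_erase _ h.1⟩
  · rintro ⟨a, J⟩ h
    simp only [mem_sigma, mem_powerset] at h
    have : a ∉ J := fun hJ => by simpa using h.2 hJ
    simp [erase_insert this]
  · rintro ⟨J, a⟩ h
    simp only [mem_sigma, mem_powerset] at h
    simp [insert_erase h.2]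
  · rintro ⟨a, J⟩ h
    simp only [mem_sigma, mem_powerset] at h
    have haJ : a ∉ J := fun hJ => by simpa using h.2 hJ
    have hK : A \ insert a J = A.erase a \ J := by
      ext b
      simp only [mem_sdiff, mem_insert, mem_erase]
      tauto
    simp only
    rw [hK, erase_insert haJ, card_insert_of_notMem haJ, prod_insert haJ,
      crossFactor_insert_left _ _ _ haJ, ← prod_sdiff h.2]
    ring

theorem heightGen_mul {q t : ℂ} (hq : ‖q‖ ≤ 1) {z : Fin n → ℂ} (hz : Function.Injective z)
    (h1 : ∀ a, z a ≠ 1) (h0 : ∀ a, z a ≠ 0) (hφ : ∀ a, ‖hop t z a‖ < 1) (y : ℕ) (Q : ℂ)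
    (A : Finset (Fin n)) :
    heightGen q t z (hop t z) (fun a => (1 - z a)⁻¹) y (q * Q) A =
      heightGen q t z (hop t z) (fun a => (1 - z a)⁻¹) y Q A - Q * (1 - q) *
        ∑ a ∈ A, hop t z a ^ y * (∏ b ∈ A.erase a, pairFactor q z a b) *
          heightGen q t z (hop t z) (fun a => (1 - z a)⁻¹) y Q (A.erase a) := by
  simp only [heightGen_eq_sum hq z hφ, totalWeight_eq_one hq hz h1 hφ, one_mul]
  rw [sum_mul_splitting_erase z hz h0 (fun a => hop t z a ^ y), ← sum_sub_distrib]
  refine sum_congr rfl fun J _ => ?_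
  rw [mul_pow]
  ring

end Moments

section Symmetrization

theorem prod_pairs_succ {m : ℕ} {M : Type*} [CommMonoid M] (F : Fin (m + 1) → Fin (m + 1) → M) :
    ∏ p ∈ (univ : Finset (Fin (m + 1) × Fin (m + 1))) with p.1 < p.2, F p.1 p.2 =
      (∏ j : Fin m, F 0 j.succ) *
        ∏ p ∈ (univ : Finset (Fin m × Fin m)) with p.1 < p.2, F p.1.succ p.2.succ := by
  simp only [prod_filter, Fintype.prod_prod_type, Fin.prod_univ_succ]
  simp [Fin.succ_lt_succ_iff]

theorem prod_rank_fiberwise {ι M : Type*} [LinearOrder ι] [CommMonoid M] (g : ℕ → M)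
    (A : Finset ι) (κ : ι → ℕ) (N : ℕ) (hN : ∀ a ∈ A, κ a < N) :
    ∏ a ∈ A, g #{b ∈ A | b < a ∧ κ b = κ a} =
      ∏ k ∈ range N, ∏ i ∈ range #{a ∈ A | κ a = k}, g i := by
  rw [← prod_fiberwise_of_maps_to (g := κ) (t := range N) fun a ha => mem_range.2 (hN a ha)]
  refine prod_congr rfl fun k _ => ?_
  rw [← prod_rank]
  refine prod_congr rfl fun a ha => ?_
  rw [filter_filter]
  congr 2
  ext b
  simp only [mem_filter, (mem_filter.1 ha).2]
  tauto

/-- The summand attached to an enumeration `σ` of `A` along which `κ` weakly decreases. -/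
def orderWeight {ι : Type*} [DecidableEq ι] (q : ℂ) (u : ι → ℂ) (κ : ι → ℕ) (m : ℕ)
    (A : Finset ι) (σ : Fin m → ι) : ℂ :=
  open Classical in
  if Function.Injective σ ∧ (∀ i, σ i ∈ A) ∧ Antitone (κ ∘ σ) then
    ∏ p ∈ (univ : Finset (Fin m × Fin m)) with p.1 < p.2, pairFactor q u (σ p.1) (σ p.2)
  else 0

variable {ι : Type*} [DecidableEq ι]

theorem image_eq_of_injective {m : ℕ} {A : Finset ι} (hA : #A = m) {σ : Fin m → ι}
    (hσ : Function.Injective σ) (h : ∀ i, σ i ∈ A) : univ.image σ = A :=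
  eq_of_subset_of_card_le (image_subset_iff.2 fun i _ => h i)
    (by rw [card_image_of_injective _ hσ, card_fin, hA])

theorem orderWeight_cons (q : ℂ) (u : ι → ℂ) (κ : ι → ℕ) {m : ℕ} {A : Finset ι}
    (hA : #A = m + 1) (a : ι) (τ : Fin m → ι) :
    orderWeight q u κ (m + 1) A (Fin.cons a τ) = if a ∈ A ∧ ∀ b ∈ A, κ b ≤ κ a then
      (∏ b ∈ A.erase a, pairFactor q u a b) * orderWeight q u κ m (A.erase a) τ else 0 := by
  have himg : a ∈ A → Function.Injective τ → (∀ i, τ i ∈ A.erase a) →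
      univ.image τ = A.erase a := fun ha hτ h =>
    image_eq_of_injective (by rw [card_erase_of_mem ha, hA]; rfl) hτ h
  have hanti : Antitone (κ ∘ (Fin.cons a τ : Fin (m + 1) → ι)) ↔
      (∀ i, κ (τ i) ≤ κ a) ∧ Antitone (κ ∘ τ) := by
    constructor
    · exact fun h => ⟨fun i => h (Fin.zero_le i.succ), fun i j hij => h (Fin.succ_le_succ_iff.2 hij)⟩
    · rintro ⟨h1, h2⟩ i j hij
      induction j using Fin.cases with
      | zero => rw [Fin.le_zero_iff.1 hij]
      | succ j =>
        induction i using Fin.cases with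
        | zero => exact h1 j
        | succ i => exact h2 (Fin.succ_le_succ_iff.1 hij)
  have hiff : (Function.Injective (Fin.cons a τ : Fin (m + 1) → ι) ∧
      (∀ i, (Fin.cons a τ : Fin (m + 1) → ι) i ∈ A) ∧
      Antitone (κ ∘ (Fin.cons a τ : Fin (m + 1) → ι))) ↔ (a ∈ A ∧ ∀ b ∈ A, κ b ≤ κ a) ∧
      (Function.Injective τ ∧ (∀ i, τ i ∈ A.erase a) ∧ Antitone (κ ∘ τ)) := by
    rw [Fin.cons_injective_iff, Fin.forall_fin_succ, hanti]
    simp only [Fin.cons_zero, Fin.cons_succ, mem_erase, Set.mem_range, not_exists]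
    constructor
    · rintro ⟨⟨h1, h2⟩, ⟨h3, h4⟩, h5, h6⟩
      have h7 : ∀ i, τ i ∈ A.erase a := fun i => mem_erase.2 ⟨h1 i, h4 i⟩
      refine ⟨⟨h3, fun b hb => ?_⟩, h2, fun i => ⟨h1 i, h4 i⟩, h6⟩
      rcases eq_or_ne b a with rfl | hba
      · exact le_rfl
      · have : b ∈ univ.image τ := by rw [himg h3 h2 h7]; exact mem_erase.2 ⟨hba, hb⟩
        obtain ⟨i, -, rfl⟩ := mem_image.1 this
        exact h5 i
    · rintro ⟨⟨h1, h2⟩, h3, h4, h5⟩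
      exact ⟨⟨fun i => (h4 i).1, h3⟩, ⟨h1, fun i => (h4 i).2⟩, fun i => h2 _ (h4 i).2, h5⟩
  simp only [orderWeight]
  rw [if_congr hiff rfl rfl, ite_and]
  split_ifs with ha h1
  · rw [prod_pairs_succ fun i j => pairFactor q u ((Fin.cons a τ : Fin (m + 1) → ι) i)
      ((Fin.cons a τ : Fin (m + 1) → ι) j)]
    simp only [Fin.cons_zero, Fin.cons_succ]
    rw [← himg ha.1 h1.1 h1.2.1, prod_image fun i _ j _ h => h1.1 h]
  · simp
  · rfl

theorem sum_orderWeight {q : ℂ} (hq : ‖q‖ < 1) [Fintype ι] (u : ι → ℂ) (hu : Function.Injective u)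
    (h0 : ∀ a, u a ≠ 0) (κ : ι → ℕ) (N m : ℕ) (A : Finset ι) (hA : #A = m)
    (hN : ∀ a ∈ A, κ a < N) :
    (1 - q) ^ m * ∑ σ : Fin m → ι, orderWeight q u κ m A σ =
      (∏ a ∈ A, ∏ b ∈ A with κ b < κ a, pairFactor q u a b) *
        ∏ k ∈ range N, qPoch q q #{a ∈ A | κ a = k} := by
  induction m generalizing A with
  | zero =>
    obtain rfl := card_eq_zero.1 hA
    simp [orderWeight, qPoch, Antitone, Function.Injective]
  | succ m ih =>
    rw [← (Fin.consEquiv fun _ : Fin (m + 1) => ι).sum_comp, Fintype.sum_prod_type]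
    simp only [Fin.consEquiv, Equiv.coe_fn_mk, orderWeight_cons q u κ hA]
    obtain ⟨c, hc, hmax⟩ := A.exists_max_image κ (card_pos.1 (by omega))
    have hcond : ∀ a, (a ∈ A ∧ ∀ b ∈ A, κ b ≤ κ a) ↔ a ∈ {a ∈ A | κ a = κ c} := by
      intro a
      rw [mem_filter]
      exact and_congr_right fun ha => ⟨fun h => le_antisymm (hmax a ha) (h c hc),
        fun h => h ▸ hmax⟩
    simp only [hcond]
    set B := {a ∈ A | κ a = κ c} with hB
    have step : ∀ a ∈ B, (∏ b ∈ A.erase a, pairFactor q u a b) *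
        ((1 - q) ^ m * ∑ τ : Fin m → ι, orderWeight q u κ m (A.erase a) τ) * (1 - q ^ #B) =
        ((∏ a ∈ A, ∏ b ∈ A with κ b < κ a, pairFactor q u a b) *
          ∏ k ∈ range N, qPoch q q #{a ∈ A | κ a = k}) *
          ∏ b ∈ B.erase a, pairFactor q u a b := by
      intro a ha
      obtain ⟨haA, hac⟩ := mem_filter.1 ha
      rw [ih (A.erase a) (by rw [card_erase_of_mem haA, hA]; rfl)
        fun b hb => hN b (mem_of_mem_erase hb)]
      have e1 : ∏ b ∈ A.erase a, pairFactor q u a b =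
          (∏ b ∈ A with κ b < κ a, pairFactor q u a b) * ∏ b ∈ B.erase a, pairFactor q u a b := by
        rw [← prod_union]
        · congr 1
          ext b
          simp only [hB, mem_erase, mem_union, mem_filter]
          constructor
          · rintro ⟨h1, h2⟩
            rcases (hmax b h2).lt_or_eq with h | h
            · exact Or.inl ⟨h2, by omega⟩
            · exact Or.inr ⟨h1, h2, h⟩
          · rintro (⟨h1, h2⟩ | ⟨h1, h2, -⟩)
            · exact ⟨fun h => by simp [h] at h2, h1⟩
            · exact ⟨h1, h2⟩
        · refine disjoint_left.2 fun b hb hb' => ?_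
          simp only [hB, mem_erase, mem_filter] at hb hb'
          omega
      have e2 : ∏ a' ∈ A.erase a, ∏ b ∈ A.erase a with κ b < κ a', pairFactor q u a' b =
          ∏ a' ∈ A.erase a, ∏ b ∈ A with κ b < κ a', pairFactor q u a' b := by
        refine prod_congr rfl fun a' ha' => ?_
        rw [filter_erase, erase_eq_of_notMem]
        simp only [mem_filter, not_and, not_lt]
        exact fun _ => hac ▸ hmax a' (mem_of_mem_erase ha')
      have hrange : κ c ∈ range N := mem_range.2 (hN c hc)
      have e3 : (∏ k ∈ range N, qPoch q q #{a ∈ A | κ a = k}) =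
          (∏ k ∈ range N, qPoch q q #{b ∈ A.erase a | κ b = k}) * (1 - q ^ #B) := by
        rw [← mul_prod_erase _ _ hrange, ← mul_prod_erase _ _ hrange, ← hB]
        have : ∏ k ∈ (range N).erase (κ c), qPoch q q #{a ∈ A | κ a = k} =
            ∏ k ∈ (range N).erase (κ c), qPoch q q #{b ∈ A.erase a | κ b = k} := by
          refine prod_congr rfl fun k hk => ?_
          rw [filter_erase, erase_eq_of_notMem]
          simp only [mem_filter, not_and]
          exact fun _ h => (mem_erase.1 hk).1 (h ▸ hac)
        rw [this, filter_erase, ← hB]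
        obtain ⟨k, hk⟩ : ∃ k, #B = k + 1 :=
          ⟨#B - 1, by have := card_pos.2 ⟨a, ha⟩; omega⟩
        rw [card_erase_of_mem ha, hk, Nat.add_sub_cancel, qPoch, prod_range_succ, ← qPoch, pow_succ']
        ring
      rw [e1, e2, e3, ← mul_prod_erase _ _ haA]
      ring
    have hne : 1 - q ^ #B ≠ 0 := by
      refine (isUnit_one_sub_of_norm_lt_one ?_).ne_zero
      rw [norm_pow]
      exact pow_lt_one₀ (norm_nonneg _) hq
        (card_pos.2 ⟨c, (hcond c).1 ⟨hc, hmax⟩⟩).ne'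
    have hsum := sum_congr rfl step
    rw [← mul_sum, ← sum_mul] at hsum
    refine mul_right_cancel₀ hne ?_
    have e4 : ∑ a, ∑ τ : Fin m → ι, (if a ∈ B then (∏ b ∈ A.erase a, pairFactor q u a b) *
        orderWeight q u κ m (A.erase a) τ else 0) = ∑ a ∈ B, (∏ b ∈ A.erase a, pairFactor q u a b) *
        ∑ τ : Fin m → ι, orderWeight q u κ m (A.erase a) τ := by
      rw [← sum_subset (subset_univ B) fun a _ ha => by simp [ha]]
      refine sum_congr rfl fun a ha => ?_
      simp only [ha, if_true, mul_sum]
    have e5 : (1 - q) ^ m * ∑ a ∈ B, (∏ b ∈ A.erase a, pairFactor q u a b) *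
        ∑ τ : Fin m → ι, orderWeight q u κ m (A.erase a) τ = ∑ a ∈ B,
          (∏ b ∈ A.erase a, pairFactor q u a b) *
            ((1 - q) ^ m * ∑ τ : Fin m → ι, orderWeight q u κ m (A.erase a) τ) := by
      rw [mul_sum]
      exact sum_congr rfl fun a _ => by ring
    rw [← e5] at hsum
    rw [e4, pow_succ']
    linear_combination (1 - q) * hsum + ((∏ a ∈ A, ∏ b ∈ A with κ b < κ a, pairFactor q u a b) *
      ∏ k ∈ range N, qPoch q q #{a ∈ A | κ a = k}) * sum_prod_pairFactor q u hu h0 B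

theorem sum_perm_orderWeight {n : ℕ} (q : ℂ) (u : Fin n → ℂ) (κ : Fin n → ℕ) :
    ∑ σ : Fin n → Fin n, orderWeight q u κ n univ σ =
      ∑ σ : Equiv.Perm (Fin n), if Antitone (κ ∘ σ) then
        ∏ p ∈ (univ : Finset (Fin n × Fin n)) with p.1 < p.2, pairFactor q u (σ p.1) (σ p.2)
      else 0 := by
  classical
  refine (Fintype.sum_of_injective (fun σ : Equiv.Perm (Fin n) => (σ : Fin n → Fin n))
    DFunLike.coe_injective _ _ (fun σ hσ => if_neg fun h => hσ ?_) fun σ => ?_).symm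
  · exact ⟨Equiv.ofBijective σ (Finite.injective_iff_bijective.1 h.1), rfl⟩
  · simp [σ.injective]

end Symmetrization

section Law

variable {n : ℕ}

/-- The ratio of the q-Pochhammer products of the multiplicities of `κ`. -/
def multRatio (q t : ℂ) (κ : Fin n → ℕ) : ℂ :=
  ∏ a, (1 - t * q ^ #{b | b < a ∧ κ b = κ a}) / (1 - q * q ^ #{b | b < a ∧ κ b = κ a})

theorem one_sub_mul_pow_ne_zero {q : ℂ} (hq : ‖q‖ < 1) (k : ℕ) : 1 - q * q ^ k ≠ 0 := by
  refine (isUnit_one_sub_of_norm_lt_one ?_).ne_zero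
  rw [← pow_succ', norm_pow]
  exact pow_lt_one₀ (norm_nonneg _) hq k.succ_ne_zero

theorem norm_multRatio_le {q : ℂ} (hq : ‖q‖ < 1) (t : ℂ) (κ : Fin n → ℕ) :
    ‖multRatio q t κ‖ ≤ ((1 + ‖t‖) / (1 - ‖q‖)) ^ n := by
  have hq' : 0 < 1 - ‖q‖ := sub_pos.2 hq
  rw [multRatio, norm_prod]
  calc _ ≤ ∏ _a : Fin n, ((1 + ‖t‖) / (1 - ‖q‖)) := by
        refine prod_le_prod (fun a _ => norm_nonneg _) fun a _ => ?_
        generalize #{b | b < a ∧ κ b = κ a} = k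
        have hk : ‖q‖ ^ k ≤ 1 := pow_le_one₀ (norm_nonneg _) hq.le
        rw [norm_div]
        refine div_le_div₀ (by positivity) ?_ hq' ?_
        · refine (norm_sub_le _ _).trans ?_
          rw [norm_one, norm_mul, norm_pow]
          gcongr
          exact mul_le_of_le_one_right (norm_nonneg _) hk
        · refine le_trans ?_ (norm_sub_norm_le _ _)
          rw [norm_one, norm_mul, norm_pow]
          gcongr
          exact mul_le_of_le_one_right (norm_nonneg _) hk
    _ = _ := by rw [prod_const, card_univ, Fintype.card_fin]

theorem multRatio_eq_prod (q t : ℂ) (κ : Fin n → ℕ) (N : ℕ) (hN : ∀ a, κ a < N) :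
    multRatio q t κ = ∏ k ∈ range N, qPoch t q (mult κ k) / qPoch q q (mult κ k) := by
  rw [multRatio, prod_rank_fiberwise (fun i => (1 - t * q ^ i) / (1 - q * q ^ i)) univ κ N
    fun a _ => hN a]
  simp [qPoch, mult]

theorem cconst_eq (q s : ℂ) (κ : Fin n → ℕ) : cconst q s κ = multRatio q (s ^ 2) κ := by
  obtain ⟨N, hN⟩ : ∃ N, ∀ a, κ a < N :=
    ⟨univ.sup κ + 1, fun a => Nat.lt_succ_of_le (le_sup (mem_univ a))⟩
  rw [multRatio_eq_prod q _ κ N hN, cconst]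
  refine finprod_eq_prod_of_mulSupport_subset _ fun k hk => ?_
  by_contra hkN
  refine hk ?_
  have : mult κ k = 0 := by
    rw [mult, card_eq_zero, filter_eq_empty_iff]
    intro a _ h
    exact hkN (by simpa [← h] using hN a)
  simp [this, qPoch]

theorem multRatio_comp_perm (q t : ℂ) (κ : Fin n → ℕ) (σ : Equiv.Perm (Fin n)) :
    multRatio q t (κ ∘ σ) = multRatio q t κ := by
  obtain ⟨N, hN⟩ : ∃ N, ∀ a, κ a < N :=
    ⟨univ.sup κ + 1, fun a => Nat.lt_succ_of_le (le_sup (mem_univ a))⟩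
  rw [multRatio_eq_prod q t κ N hN, multRatio_eq_prod q t (κ ∘ σ) N fun a => hN (σ a)]
  have : ∀ k, mult (κ ∘ σ) k = mult κ k := fun k => by
    simp only [mult]
    exact card_bijective σ σ.bijective (by simp)
  simp [this]

theorem cfgWeight_univ {q : ℂ} (hq : ‖q‖ < 1) (t : ℂ) {u : Fin n → ℂ}
    (hu : Function.Injective u) (h0 : ∀ a, u a ≠ 0) (φ d : Fin n → ℂ) (κ : Fin n → ℕ) :
    cfgWeight q t u φ d univ κ = ∑ σ : Equiv.Perm (Fin n), if Antitone (κ ∘ σ) then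
      (1 - q) ^ n * (∏ a, d a) * multRatio q t κ * (∏ a, φ a ^ κ a) *
        ∏ p ∈ (univ : Finset (Fin n × Fin n)) with p.1 < p.2, pairFactor q u (σ p.1) (σ p.2)
      else 0 := by
  obtain ⟨N, hN⟩ : ∃ N, ∀ a, κ a < N :=
    ⟨univ.sup κ + 1, fun a => Nat.lt_succ_of_le (le_sup (mem_univ a))⟩
  have hG := sum_orderWeight hq u hu h0 κ N n univ (by simp) fun a _ => hN a
  rw [sum_perm_orderWeight] at hG
  have hR : multRatio q t κ * ∏ k ∈ range N, qPoch q q #{a | κ a = k} =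
      ∏ a, (1 - t * q ^ #{b | b < a ∧ κ b = κ a}) := by
    have := prod_rank_fiberwise (fun i => 1 - q * q ^ i) univ κ N fun a _ => hN a
    have hP : ∏ k ∈ range N, qPoch q q #{a | κ a = k} =
        ∏ a, (1 - q * q ^ #{b | b < a ∧ κ b = κ a}) := this.symm
    rw [hP, multRatio, ← prod_mul_distrib]
    exact prod_congr rfl fun a _ => div_mul_cancel₀ _ (one_sub_mul_pow_ne_zero hq _)
  calc cfgWeight q t u φ d univ κ = (∏ a, d a) * (∏ a, φ a ^ κ a) *
        (∏ a, (1 - t * q ^ #{b | b < a ∧ κ b = κ a})) *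
        ∏ a, ∏ b with κ b < κ a, pairFactor q u a b := by
        simp only [cfgWeight, prod_mul_distrib]
        ring
    _ = (∏ a, d a) * (∏ a, φ a ^ κ a) * multRatio q t κ * ((1 - q) ^ n *
        ∑ σ : Equiv.Perm (Fin n), if Antitone (κ ∘ σ) then
          ∏ p ∈ (univ : Finset (Fin n × Fin n)) with p.1 < p.2, pairFactor q u (σ p.1) (σ p.2)
        else 0) := by
        rw [hG, ← hR]
        ring
    _ = _ := by
        rw [mul_sum, mul_sum]
        refine sum_congr rfl fun σ _ => ?_
        split_ifs <;> ring

theorem pairFactor_mul_left {s : ℂ} (hs : s ≠ 0) (q : ℂ) (u : Fin n → ℂ) (a b : Fin n) :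
    pairFactor q (fun a => s * u a) a b = pairFactor q u a b := by
  rw [pairFactor, pairFactor, ← mul_div_mul_left (u a - q * u b) _ hs]
  congr 1 <;> ring

theorem Mwt_succ {q s : ℂ} (hs : s ≠ 0) (u : Fin n → ℂ) (μ : Fin n → ℕ) :
    Mwt q s u (fun i => μ i + 1) = ∑ σ : Equiv.Perm (Fin n),
      (1 - q) ^ n * (∏ a, (1 - s * u a)⁻¹) * multRatio q (s ^ 2) μ *
        (∏ i, hop (s ^ 2) (fun a => s * u a) (σ i) ^ μ i) *
        ∏ p ∈ (univ : Finset (Fin n × Fin n)) with p.1 < p.2,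
          pairFactor q (fun a => s * u a) (σ p.1) (σ p.2) := by
  have hexp : ∑ i, (μ i + 1) - n = ∑ i, μ i := by simp [sum_add_distrib]
  simp only [Mwt, Fc, Ffun, cconst_eq, Nat.add_sub_cancel, hexp, pairFactor_mul_left hs]
  rw [if_pos fun i => Nat.le_add_left 1 (μ i), one_mul, mul_sum, mul_sum, mul_sum]
  refine sum_congr rfl fun σ _ => ?_
  have h : ∏ i, hop (s ^ 2) (fun a => s * u a) (σ i) ^ μ i =
      (-s) ^ (∑ i, μ i) * ∏ i, ((u (σ i) - s) / (1 - s * u (σ i))) ^ μ i := by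
    rw [← prod_pow_eq_pow_sum, ← prod_mul_distrib]
    refine prod_congr rfl fun i _ => ?_
    rw [← mul_pow, hop]
    ring
  rw [h, prod_inv_distrib]
  simp only [pairFactor]
  ring

theorem hasSum_Mwt {q s : ℂ} (hq : ‖q‖ < 1) (hs : s ≠ 0) {u : Fin n → ℂ}
    (hu : Function.Injective u) (h0 : ∀ a, u a ≠ 0)
    (hφ : ∀ a, ‖hop (s ^ 2) (fun a => s * u a) a‖ < 1) (x : ℕ) {Q : ℂ}
    (hQ : ‖Q‖ ≤ 1) :
    HasSum (fun ν : Sign n => Mwt q s u ν.1 * Q ^ height ν.1 x)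
      (heightGen q (s ^ 2) (fun a => s * u a) (hop (s ^ 2) fun a => s * u a)
        (fun a => (1 - s * u a)⁻¹) (x - 1) Q univ) := by
  set φ := hop (s ^ 2) fun a => s * u a with hφd
  set d : Fin n → ℂ := fun a => (1 - s * u a)⁻¹ with hd
  have hz : Function.Injective fun a => s * u a := fun a b h => hu (mul_left_cancel₀ hs h)
  have hz0 : ∀ a, s * u a ≠ 0 := fun a => mul_ne_zero hs (h0 a)
  let X : Equiv.Perm (Fin n) → (Fin n → ℕ) → ℂ := fun σ κ =>
    (1 - q) ^ n * (∏ a, d a) * multRatio q (s ^ 2) κ * (∏ a, φ a ^ κ a) *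
      (∏ p ∈ (univ : Finset (Fin n × Fin n)) with p.1 < p.2,
        pairFactor q (fun a => s * u a) (σ p.1) (σ p.2)) * Q ^ #{a | x - 1 ≤ κ a}
  have hX : ∀ σ : Equiv.Perm (Fin n), Summable fun κ => if Antitone (κ ∘ σ) then X σ κ else 0 := by
    intro σ
    refine Summable.of_norm_bounded ((summable_prod_pow (fun a => ‖φ a‖)
      (fun a => norm_nonneg _) hφ).mul_left (‖(1 - q) ^ n * (∏ a, d a)‖ *
        ((1 + ‖s ^ 2‖) / (1 - ‖q‖)) ^ n *
        ‖∏ p ∈ (univ : Finset (Fin n × Fin n)) with p.1 < p.2,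
          pairFactor q (fun a => s * u a) (σ p.1) (σ p.2)‖)) fun κ => ?_
    have hR := norm_multRatio_le hq (s ^ 2) κ
    have h1 : ‖Q ^ #{a | x - 1 ≤ κ a}‖ ≤ 1 := by
      rw [norm_pow]
      exact pow_le_one₀ (norm_nonneg _) hQ
    have h2 : ‖∏ a, φ a ^ κ a‖ = ∏ a, ‖φ a‖ ^ κ a := by simp
    have h3 : 0 ≤ ((1 + ‖s ^ 2‖) / (1 - ‖q‖)) ^ n := (norm_nonneg _).trans hR
    split_ifs
    · simp only [X, norm_mul _ (Q ^ _), norm_mul _ (∏ p ∈ _ with _, _), norm_mul _ (∏ a, φ a ^ _),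
        norm_mul _ (multRatio _ _ _), h2]
      refine (mul_le_of_le_one_right (by positivity) h1).trans ?_
      rw [mul_right_comm]
      gcongr
    · rw [norm_zero]
      positivity
  have hsum := hasSum_sum fun (σ : Equiv.Perm (Fin n)) (_ : σ ∈ univ) => (hX σ).hasSum
  have htot : heightGen q (s ^ 2) (fun a => s * u a) φ d (x - 1) Q univ =
      ∑ σ : Equiv.Perm (Fin n), ∑' κ, if Antitone (κ ∘ σ) then X σ κ else 0 := by
    rw [← hsum.tsum_eq, heightGen, ← (Equiv.subtypeUnivEquiv (p := fun κ : Fin n → ℕ =>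
      ∀ a, a ∉ univ → κ a = 0) fun κ a ha => absurd (mem_univ a) ha).tsum_eq]
    refine tsum_congr fun κ => ?_
    rw [cfgWeight_univ hq _ hz hz0, sum_mul]
    refine sum_congr rfl fun σ _ => ?_
    simp only [Equiv.subtypeUnivEquiv_apply, X]
    split_ifs <;> simp
  have hsign : ∀ σ : Equiv.Perm (Fin n), HasSum (fun μ : Sign n => X σ (μ.1 ∘ σ.symm))
      (∑' κ, if Antitone (κ ∘ σ) then X σ κ else 0) := by
    intro σ
    have h1 := (hX σ).hasSum
    have hg : Function.Injective fun μ : Sign n => μ.1 ∘ σ.symm := fun μ ν h =>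
      Subtype.ext (σ.symm.surjective.injective_comp_right h)
    rw [← hg.hasSum_iff] at h1
    · refine h1.congr_fun fun μ => ?_
      have : Antitone ((μ.1 ∘ σ.symm) ∘ σ) := by
        have h : Antitone μ.1 := fun i j h => μ.2 i j h
        simpa [Function.comp_assoc] using h
      simp only [Function.comp_apply]
      rw [if_pos this]
    · refine fun κ hκ => if_neg fun h => hκ ⟨⟨κ ∘ σ, fun i j hij => h hij⟩, ?_⟩
      simp [Function.comp_assoc]
  have hmain := hasSum_sum fun (σ : Equiv.Perm (Fin n)) (_ : σ ∈ univ) => hsign σ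
  rw [htot]
  have hinj : Function.Injective fun μ : Sign n =>
      (⟨fun i => μ.1 i + 1, fun i j h => Nat.succ_le_succ (μ.2 i j h)⟩ : Sign n) := by
    intro μ ν h
    refine Subtype.ext (funext fun i => ?_)
    simpa using congrFun (congrArg Subtype.val h) i
  rw [← hinj.hasSum_iff]
  · refine hmain.congr_fun fun μ => ?_
    have hh : height (fun i => μ.1 i + 1) x = #{a | x - 1 ≤ μ.1 a} := by
      rw [height]
      congr 1
      ext a
      simp
    simp only [Function.comp_apply]
    rw [Mwt_succ hs, hh, sum_mul]
    refine sum_congr rfl fun σ _ => ?_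
    simp only [X]
    rw [multRatio_comp_perm, ← Equiv.prod_comp σ fun a => φ a ^ (μ.1 ∘ σ.symm) a]
    have hc : #{a | x - 1 ≤ (μ.1 ∘ σ.symm) a} = #{a | x - 1 ≤ μ.1 a} :=
      card_bijective σ.symm σ.symm.bijective (by simp)
    rw [hc]
    simp [hφd, hd]
  · intro ν hν
    rw [Mwt, if_neg, zero_mul, zero_mul, zero_mul]
    refine fun h => hν ⟨⟨fun i => ν.1 i - 1, fun i j hij => Nat.sub_le_sub_right (ν.2 i j hij) 1⟩,
      Subtype.ext (funext fun i => Nat.sub_add_cancel (h i))⟩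

end Law

section Contours

variable {I : Type}

/-- The integral over the union of the circles with centers `c j` and radii `R j`. -/
def contourInt [Fintype I] (c : I → ℂ) (R : I → ℝ) (g : ℂ → ℂ) : ℂ := ∑ j, ∮ z in C(c j, R j), g z

theorem continuous_deriv_circleMap (c : ℂ) (R : ℝ) : Continuous (deriv (circleMap c R)) := by
  have : deriv (circleMap c R) = fun θ => circleMap 0 R θ * Complex.I :=
    funext fun θ => deriv_circleMap c R θ
  rw [this]
  fun_prop

theorem contourInt_congr [Fintype I] {c : I → ℂ} {R : I → ℝ} {g h : ℂ → ℂ}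
    (H : ∀ j θ, g (circleMap (c j) (R j) θ) = h (circleMap (c j) (R j) θ)) :
    contourInt c R g = contourInt c R h := by
  simp only [contourInt, circleIntegral, H]

theorem contourInt_const_mul [Fintype I] (c : I → ℂ) (R : I → ℝ) (a : ℂ) (g : ℂ → ℂ) :
    contourInt c R (fun z => a * g z) = a * contourInt c R g := by
  simp only [contourInt, circleIntegral.integral_const_mul, mul_sum]

variable {k : ℕ}

theorem iterInt_congr [Fintype I] (c : I → ℂ) (R : Fin k → I → ℝ) {f g : (Fin k → ℂ) → ℂ}
    (H : ∀ (j : Fin k → I) (θ : Fin k → ℝ),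
      f (fun i => circleMap (c (j i)) (R i (j i)) (θ i)) =
        g (fun i => circleMap (c (j i)) (R i (j i)) (θ i))) :
    iterInt k (fun i => contourInt c (R i)) f = iterInt k (fun i => contourInt c (R i)) g := by
  induction k with
  | zero =>
    have := H Fin.elim0 Fin.elim0
    simp only [iterInt]
    convert this
  | succ k ih =>
    simp only [iterInt]
    refine contourInt_congr fun j θ => ih (fun i => R i.succ) fun j' θ' => ?_
    have := H (Fin.cons j j') (Fin.cons θ θ')
    convert this using 2 <;>
    · funext i
      induction i using Fin.cases <;> rfl

theorem iterInt_const_mul [Fintype I] (c : I → ℂ) (R : Fin k → I → ℝ) (a : ℂ) (f : (Fin k → ℂ) → ℂ) :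
    iterInt k (fun i => contourInt c (R i)) (fun w => a * f w) =
      a * iterInt k (fun i => contourInt c (R i)) f := by
  induction k with
  | zero => rfl
  | succ k ih =>
    simp only [iterInt]
    rw [← contourInt_const_mul]
    congr 1
    funext z
    exact ih (fun i => R i.succ) fun w => f (Fin.cons z w)

/-- Joint continuity of `f` in the parameter and in the angles, along every choice of circles. -/
def ContinuousAlong {X : Type} [TopologicalSpace X] (c : I → ℂ) (R : Fin k → I → ℝ)
    (f : X → (Fin k → ℂ) → ℂ) : Prop :=
  ∀ j : Fin k → I, Continuous fun p : X × (Fin k → ℝ) =>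
    f p.1 fun i => circleMap (c (j i)) (R i (j i)) (p.2 i)

theorem ContinuousAlong.cons {X : Type} [TopologicalSpace X] {c : I → ℂ}
    {R : Fin (k + 1) → I → ℝ} {f : X → (Fin (k + 1) → ℂ) → ℂ} (hf : ContinuousAlong c R f) (j : I) :
    ContinuousAlong c (fun i => R i.succ) fun (p : X × ℝ) w =>
      f p.1 (Fin.cons (circleMap (c j) (R 0 j) p.2) w) := by
  intro j'
  have hg : Continuous fun p : (X × ℝ) × (Fin k → ℝ) =>
      ((p.1.1, Fin.cons p.1.2 p.2) : X × (Fin (k + 1) → ℝ)) := by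
    refine (continuous_fst.comp continuous_fst).prodMk (continuous_pi fun i => ?_)
    induction i using Fin.cases with
    | zero => exact continuous_snd.comp continuous_fst
    | succ i => exact (continuous_apply i).comp continuous_snd
  refine ((hf (Fin.cons j j')).comp hg).congr fun p => ?_
  simp only [Function.comp_apply]
  congr 1
  funext i
  induction i using Fin.cases <;> rfl

theorem ContinuousAlong.continuous_iterInt [Fintype I] {X : Type} [TopologicalSpace X] {c : I → ℂ}
    {R : Fin k → I → ℝ} {f : X → (Fin k → ℂ) → ℂ} (hf : ContinuousAlong c R f) :
    Continuous fun x => iterInt k (fun i => contourInt c (R i)) (f x) := by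
  induction k generalizing X with
  | zero =>
    have h0 : Continuous fun x : X => ((x, Fin.elim0) : X × (Fin 0 → ℝ)) :=
      continuous_id.prodMk continuous_const
    refine ((hf Fin.elim0).comp h0).congr ?_
    intro x
    simp only [iterInt, Function.comp_apply]
    congr 1
    exact Subsingleton.elim _ _
  | succ k ih =>
    simp only [iterInt, contourInt, circleIntegral]
    refine continuous_finsetSum _ fun j _ => ?_
    refine intervalIntegral.continuous_parametric_intervalIntegral_of_continuous' ?_ _ _
    exact ((continuous_deriv_circleMap _ _).comp continuous_snd).smul (ih (hf.cons j))

theorem ContinuousAlong.integral_iterInt [Fintype I] {c : I → ℂ} {R : Fin k → I → ℝ}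
    {f : ℝ → (Fin k → ℂ) → ℂ} (hf : ContinuousAlong c R f) (a b : ℝ) :
    ∫ t in a..b, iterInt k (fun i => contourInt c (R i)) (f t) =
      iterInt k (fun i => contourInt c (R i)) fun w => ∫ t in a..b, f t w := by
  induction k with
  | zero => rfl
  | succ k ih =>
    simp only [iterInt, contourInt, circleIntegral]
    have hc : ∀ j, Continuous fun p : ℝ × ℝ => deriv (circleMap (c j) (R 0 j)) p.2 •
        iterInt k (fun i => contourInt c (R i.succ)) fun w =>
          f p.1 (Fin.cons (circleMap (c j) (R 0 j) p.2) w) := by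
      intro j
      exact ((continuous_deriv_circleMap _ _).comp continuous_snd).smul
        (hf.cons j).continuous_iterInt
    rw [intervalIntegral.integral_finsetSum]
    · refine sum_congr rfl fun j _ => ?_
      rw [MeasureTheory.intervalIntegral_intervalIntegral_swap]
      · refine intervalIntegral.integral_congr fun θ _ => ?_
        simp only [intervalIntegral.integral_smul]
        congr 1
        refine ih (R := fun i => R i.succ)
          (f := fun t w => f t (Fin.cons (circleMap (c j) (R 0 j) θ) w)) fun j' => ?_
        have hθ : Continuous fun p : ℝ × (Fin k → ℝ) => ((p.1, θ), p.2) := by fun_prop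
        exact ((hf.cons j) j').comp hθ
      · exact ((hc j).continuousOn.integrableOn_compact
          (isCompact_uIcc.prod isCompact_uIcc)).mono_set
          (Set.prod_mono Set.uIoc_subset_uIcc Set.uIoc_subset_uIcc)
    · intro j _
      refine Continuous.intervalIntegrable ?_ _ _
      exact intervalIntegral.continuous_parametric_intervalIntegral_of_continuous' (hc j) _ _

theorem circleIntegral_iterInt [Fintype I] (c : I → ℂ) (R : Fin k → I → ℝ) (c₀ : ℂ) (R₀ : ℝ)
    (f : ℂ → (Fin k → ℂ) → ℂ) (hf : ContinuousAlong c R fun θ => f (circleMap c₀ R₀ θ)) :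
    ∮ z in C(c₀, R₀), iterInt k (fun i => contourInt c (R i)) (f z) =
      iterInt k (fun i => contourInt c (R i)) fun w => ∮ z in C(c₀, R₀), f z w := by
  simp only [circleIntegral, smul_eq_mul, ← iterInt_const_mul]
  refine ContinuousAlong.integral_iterInt (f := fun θ w => _) (fun j => ?_) _ _
  exact ((continuous_deriv_circleMap _ _).comp continuous_fst).mul (hf j)

end Contours

section Integrand

variable {n : ℕ}

/-- The one-variable factor of the moment integrand with the poles `(u a)⁻¹`, `a ∈ A`. -/
def oneFactor (q s : ℂ) (u : Fin n → ℂ) (y : ℕ) (A : Finset (Fin n)) (z : ℂ) : ℂ :=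
  z⁻¹ * ((1 - s * z) / (1 - s⁻¹ * z)) ^ y * ∏ j ∈ A, (1 - q * u j * z) / (1 - u j * z)

/-- The moment integrand with the poles `(u a)⁻¹`, `a ∈ A`. -/
def momentIntegrand (q s : ℂ) (u : Fin n → ℂ) (y : ℕ) (A : Finset (Fin n)) (l : ℕ)
    (w : Fin l → ℂ) : ℂ :=
  (∏ p ∈ (univ : Finset (Fin l × Fin l)) with p.1 < p.2,
    (w p.1 - w p.2) / (w p.1 - q * w p.2)) * ∏ i, oneFactor q s u y A (w i)

theorem momentIntegrand_cons (q s : ℂ) (u : Fin n → ℂ) (y : ℕ) (A : Finset (Fin n)) (l : ℕ)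
    (z : ℂ) (w : Fin l → ℂ) :
    momentIntegrand q s u y A (l + 1) (Fin.cons z w) =
      (∏ i, (z - w i) / (z - q * w i)) * oneFactor q s u y A z * momentIntegrand q s u y A l w := by
  rw [momentIntegrand, prod_pairs_succ fun i j => ((Fin.cons z w : Fin (l + 1) → ℂ) i -
    (Fin.cons z w : Fin (l + 1) → ℂ) j) / ((Fin.cons z w : Fin (l + 1) → ℂ) i -
      q * (Fin.cons z w : Fin (l + 1) → ℂ) j), Fin.prod_univ_succ, momentIntegrand]
  simp only [Fin.cons_zero, Fin.cons_succ]
  ring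

theorem continuous_momentIntegrand {q s : ℂ} {u : Fin n → ℂ} (y : ℕ) (A : Finset (Fin n))
    {l : ℕ} {X : Type} [TopologicalSpace X] {p : Fin l → X → ℂ} (hp : ∀ i, Continuous (p i))
    (h0 : ∀ i x, p i x ≠ 0) (hs : ∀ i x, 1 - s⁻¹ * p i x ≠ 0)
    (hu : ∀ i x a, 1 - u a * p i x ≠ 0) (hq : ∀ i j x, i < j → p i x - q * p j x ≠ 0) :
    Continuous fun x => momentIntegrand q s u y A l fun i => p i x := by
  simp only [momentIntegrand, oneFactor]
  refine (continuous_finsetProd _ fun e he => ?_).mul (continuous_finsetProd _ fun i _ =>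
    (((hp i).inv₀ (h0 i)).mul (Continuous.pow (Continuous.div ?_ ?_ (hs i)) y)).mul
      (continuous_finsetProd _ fun a _ => Continuous.div ?_ ?_ fun x => hu i x a))
  · have h1 := hp e.1
    have h2 := hp e.2
    exact Continuous.div (by fun_prop) (by fun_prop) fun x => hq _ _ x (mem_filter.1 he).2
  all_goals
    have h1 := hp i
    fun_prop

/-- The regular part of the integrand in its first variable. -/
def regularPart (q s : ℂ) (u : Fin n → ℂ) (y : ℕ) (A : Finset (Fin n)) {l : ℕ} (w : Fin l → ℂ)
    (z : ℂ) : ℂ :=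
  (∏ i, (z - w i) / (z - q * w i)) * (((1 - s * z) / (1 - s⁻¹ * z)) ^ y *
    ∏ j ∈ A, (1 - q * u j * z) / (1 - u j * z))

theorem differentiableOn_regularPart {q s : ℂ} {u : Fin n → ℂ} (y : ℕ) {A : Finset (Fin n)}
    {l : ℕ} {w : Fin l → ℂ} {S : Set ℂ} (hw : ∀ z ∈ S, ∀ i, z - q * w i ≠ 0)
    (hs : ∀ z ∈ S, 1 - s⁻¹ * z ≠ 0) (hu : ∀ z ∈ S, ∀ a ∈ A, 1 - u a * z ≠ 0) :
    DifferentiableOn ℂ (regularPart q s u y A w) S := by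
  refine DifferentiableOn.fun_mul (DifferentiableOn.fun_finsetProd fun i _ => ?_)
    (DifferentiableOn.fun_mul (DifferentiableOn.fun_pow (DifferentiableOn.fun_div ?_ ?_ hs) y)
      (DifferentiableOn.fun_finsetProd fun a ha => ?_))
  · exact DifferentiableOn.fun_div (by fun_prop) (by fun_prop) fun z hz => hw z hz i
  · fun_prop
  · fun_prop
  · exact DifferentiableOn.fun_div (by fun_prop) (by fun_prop) fun z hz => hu z hz a ha

theorem circleIntegral_momentIntegrand_zero {q s : ℂ} (hq : q ≠ 0) {u : Fin n → ℂ} (y : ℕ)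
    {A : Finset (Fin n)} {l : ℕ} {w : Fin l → ℂ} (hw0 : ∀ i, w i ≠ 0) {R : ℝ} (hR : 0 < R)
    (hw : ∀ z ∈ Metric.closedBall (0 : ℂ) R, ∀ i, z - q * w i ≠ 0)
    (hs : ∀ z ∈ Metric.closedBall (0 : ℂ) R, 1 - s⁻¹ * z ≠ 0)
    (hu : ∀ z ∈ Metric.closedBall (0 : ℂ) R, ∀ a ∈ A, 1 - u a * z ≠ 0) :
    ∮ z in C(0, R), momentIntegrand q s u y A (l + 1) (Fin.cons z w) =
      2 * Real.pi * Complex.I * (q⁻¹) ^ l * momentIntegrand q s u y A l w := by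
  have h := (differentiableOn_regularPart y hw hs hu).circleIntegral_sub_inv_smul
    (Metric.mem_ball_self hR)
  have h0 : regularPart q s u y A w 0 = (q⁻¹) ^ l := by
    have : ∀ i, (0 - w i) / (0 - q * w i) = q⁻¹ := fun i => by
      have := hw0 i
      field_simp
      ring
    simp only [regularPart, this]
    simp
  rw [h0] at h
  calc _ = ∮ z in C(0, R), momentIntegrand q s u y A l w *
        ((z - 0)⁻¹ • regularPart q s u y A w z) := by
        congr 1
        funext z
        rw [momentIntegrand_cons, regularPart, oneFactor, smul_eq_mul, sub_zero]
        ring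
    _ = _ := by
        rw [circleIntegral.integral_const_mul, h, smul_eq_mul]
        ring

theorem circleIntegral_momentIntegrand_of_notMem {q s : ℂ} {u : Fin n → ℂ} (y : ℕ)
    {A : Finset (Fin n)} {l : ℕ} {w : Fin l → ℂ} {c : ℂ} {R : ℝ} (hR : 0 < R)
    (h0 : ∀ z ∈ Metric.closedBall c R, z ≠ 0)
    (hw : ∀ z ∈ Metric.closedBall c R, ∀ i, z - q * w i ≠ 0)
    (hs : ∀ z ∈ Metric.closedBall c R, 1 - s⁻¹ * z ≠ 0)
    (hu : ∀ z ∈ Metric.closedBall c R, ∀ a ∈ A, 1 - u a * z ≠ 0) :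
    ∮ z in C(c, R), momentIntegrand q s u y A (l + 1) (Fin.cons z w) = 0 := by
  have hd : DifferentiableOn ℂ (fun z => z⁻¹ * regularPart q s u y A w z)
      (Metric.closedBall c R) :=
    (differentiableOn_inv.mono fun z hz => h0 z hz).mul (differentiableOn_regularPart y hw hs hu)
  have h := (hd.diffContOnCl_ball subset_rfl).circleIntegral_eq_zero hR.le
  calc _ = ∮ z in C(c, R), momentIntegrand q s u y A l w * (z⁻¹ * regularPart q s u y A w z) := by
        congr 1
        funext z
        rw [momentIntegrand_cons, regularPart, oneFactor]
        ring
    _ = _ := by rw [circleIntegral.integral_const_mul, h, mul_zero]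

theorem oneFactor_erase {q s : ℂ} {u : Fin n → ℂ} (y : ℕ) {A : Finset (Fin n)} {a : Fin n}
    (ha : a ∈ A) {z : ℂ} (h1 : 1 - u a * z ≠ 0) (h2 : 1 - q * u a * z ≠ 0) :
    oneFactor q s u y A z * ((1 - u a * z) / (1 - q * u a * z)) =
      oneFactor q s u y (A.erase a) z := by
  have h : (1 - q * u a * z) / (1 - u a * z) * ((1 - u a * z) / (1 - q * u a * z)) = 1 := by
    rw [← inv_div (1 - q * u a * z), mul_inv_cancel₀ (div_ne_zero h2 h1)]
  rw [oneFactor, ← mul_prod_erase _ _ ha, oneFactor]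
  linear_combination (z⁻¹ * ((1 - s * z) / (1 - s⁻¹ * z)) ^ y *
    ∏ j ∈ A.erase a, (1 - q * u j * z) / (1 - u j * z)) * h

theorem circleIntegral_momentIntegrand_inv {q s : ℂ} (hs0 : s ≠ 0) {u : Fin n → ℂ} (y : ℕ)
    (hu0 : ∀ a, u a ≠ 0) {A : Finset (Fin n)} {a : Fin n} (ha : a ∈ A) {l : ℕ} {w : Fin l → ℂ}
    (hw1 : ∀ i, 1 - u a * w i ≠ 0) (hw2 : ∀ i, 1 - q * u a * w i ≠ 0) {R : ℝ} (hR : 0 < R)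
    (h0 : ∀ z ∈ Metric.closedBall (u a)⁻¹ R, z ≠ 0)
    (hw : ∀ z ∈ Metric.closedBall (u a)⁻¹ R, ∀ i, z - q * w i ≠ 0)
    (hs : ∀ z ∈ Metric.closedBall (u a)⁻¹ R, 1 - s⁻¹ * z ≠ 0)
    (hu : ∀ z ∈ Metric.closedBall (u a)⁻¹ R, ∀ b ∈ A.erase a, 1 - u b * z ≠ 0) :
    ∮ z in C((u a)⁻¹, R), momentIntegrand q s u y A (l + 1) (Fin.cons z w) =
      2 * Real.pi * Complex.I * (-(1 - q)) * (hop (s ^ 2) (fun a => s * u a) a ^ y *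
        ∏ b ∈ A.erase a, pairFactor q u a b) * momentIntegrand q s u y (A.erase a) l w := by
  have hua := hu0 a
  have hd : DifferentiableOn ℂ (fun z => -(u a)⁻¹ * (1 - q * u a * z) *
      (z⁻¹ * regularPart q s u y (A.erase a) w z)) (Metric.closedBall (u a)⁻¹ R) :=
    DifferentiableOn.mul (by fun_prop) ((differentiableOn_inv.mono fun z hz => h0 z hz).mul
      (differentiableOn_regularPart y hw hs hu))
  have h := hd.circleIntegral_sub_inv_smul (Metric.mem_ball_self hR)
  have hhop : (1 - s * (u a)⁻¹) / (1 - s⁻¹ * (u a)⁻¹) = hop (s ^ 2) (fun a => s * u a) a := by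
    rw [hop, ← mul_div_mul_left _ _ (mul_ne_zero hs0 hua), ← neg_div_neg_eq]
    congr 1 <;> field_simp <;> ring
  have hpf : ∀ b, (1 - q * u b * (u a)⁻¹) / (1 - u b * (u a)⁻¹) = pairFactor q u a b := by
    intro b
    rw [pairFactor, ← mul_div_mul_left _ _ hua]
    congr 1 <;> field_simp
  have hwf : ∀ i, ((u a)⁻¹ - w i) / ((u a)⁻¹ - q * w i) =
      (1 - u a * w i) / (1 - q * u a * w i) := by
    intro i
    rw [← mul_div_mul_left _ _ hua]
    congr 1 <;> field_simp
  have herase : momentIntegrand q s u y A l w * ∏ i, (1 - u a * w i) / (1 - q * u a * w i) =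
      momentIntegrand q s u y (A.erase a) l w := by
    rw [momentIntegrand, mul_assoc, ← prod_mul_distrib, momentIntegrand]
    congr 1
    exact prod_congr rfl fun i _ => oneFactor_erase y ha (hw1 i) (hw2 i)
  calc _ = ∮ z in C((u a)⁻¹, R), momentIntegrand q s u y A l w * ((z - (u a)⁻¹)⁻¹ •
        (-(u a)⁻¹ * (1 - q * u a * z) * (z⁻¹ * regularPart q s u y (A.erase a) w z))) := by
        congr 1
        funext z
        have hz : (1 - u a * z)⁻¹ = (z - (u a)⁻¹)⁻¹ * -(u a)⁻¹ := by
          have e : 1 - u a * z = -u a * (z - (u a)⁻¹) := by field_simp; ring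
          rw [e, mul_inv, inv_neg, mul_comm]
        rw [momentIntegrand_cons, regularPart, oneFactor, ← mul_prod_erase _ _ ha, smul_eq_mul,
          div_eq_mul_inv (1 - q * u a * z), hz]
        ring
    _ = _ := by
        rw [circleIntegral.integral_const_mul, h, smul_eq_mul, regularPart, hhop, ← herase]
        simp only [hpf, hwf]
        field_simp

end Integrand

section Contours

variable {n : ℕ}

/-- Lower bounds `d` for the distances between the points the contours have to separate. -/
structure Separated (q s : ℂ) (u : Fin n → ℂ) (d : ℝ) : Prop where
  pos : 0 < d
  norm_le : ‖q‖ ≤ 1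
  le_s : d ≤ ‖s‖
  le_inv : ∀ a, d ≤ ‖(u a)⁻¹‖
  le_mul_inv : ∀ a, d ≤ ‖q * (u a)⁻¹‖
  le_sub : ∀ a b, a ≠ b → d ≤ ‖(u a)⁻¹ - (u b)⁻¹‖
  le_sub_mul : ∀ a b, d ≤ ‖(u a)⁻¹ - q * (u b)⁻¹‖
  le_sub_s : ∀ a, d ≤ ‖(u a)⁻¹ - s‖

/-- The centers of the contours: the origin and the points `(u a)⁻¹`. -/
def center (u : Fin n → ℂ) : Option (Fin n) → ℂ
  | none => 0
  | some a => (u a)⁻¹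

/-- The radii of the contours: `R` at the origin, `δ` elsewhere. -/
def radius (R δ : ℝ) : Option (Fin n) → ℝ
  | none => R
  | some _ => δ

variable {q s : ℂ} {u : Fin n → ℂ} {d R R' δ : ℝ}

theorem radius_pos (hR : 0 < R) (hδ : 0 < δ) (j : Option (Fin n)) : 0 < radius R δ j := by
  cases j <;> assumption

theorem Separated.ne_zero (h : Separated q s u d) (a : Fin n) : u a ≠ 0 := fun h0 => by
  have := h.le_inv a
  rw [h0, inv_zero, norm_zero] at this
  exact this.not_gt h.pos

theorem Separated.s_ne_zero (h : Separated q s u d) : s ≠ 0 := fun h0 => by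
  have := h.le_s
  rw [h0, norm_zero] at this
  exact this.not_gt h.pos

theorem Separated.one_sub_inv_mul_ne_zero (h : Separated q s u d) (hR : R < d / 4) (hδ : δ < d / 4)
    {j : Option (Fin n)} {z : ℂ} (hz : ‖z - center u j‖ ≤ radius R δ j) : 1 - s⁻¹ * z ≠ 0 := by
  have hs := h.s_ne_zero
  intro h0
  have hzs : z = s := by
    field_simp at h0
    linear_combination -h0
  subst hzs
  have := h.pos
  cases j with
  | none =>
    simp only [center, radius, sub_zero] at hz
    linarith [h.le_s]
  | some a =>
    simp only [center, radius] at hz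
    rw [norm_sub_rev] at hz
    linarith [h.le_sub_s a]

theorem Separated.ne_zero_of_near_inv (h : Separated q s u d) (hδ : δ < d / 4)
    {a : Fin n} {z : ℂ} (hz : ‖z - (u a)⁻¹‖ ≤ δ) : z ≠ 0 := by
  rintro rfl
  rw [zero_sub, norm_neg] at hz
  linarith [h.le_inv a, h.pos]

theorem Separated.eq_inv (h : Separated q s u d) {a : Fin n} {z : ℂ} (h0 : 1 - u a * z = 0) :
    z = (u a)⁻¹ := by
  have := h.ne_zero a
  field_simp
  linear_combination -h0

theorem Separated.one_sub_mul_ne_zero_of_near_zero (h : Separated q s u d) (hR : R < d / 4)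
    {a : Fin n} {z : ℂ} (hz : ‖z‖ ≤ R) : 1 - u a * z ≠ 0 := by
  intro h0
  rw [h.eq_inv h0] at hz
  linarith [h.le_inv a, h.pos]

theorem Separated.one_sub_mul_ne_zero_of_near_inv (h : Separated q s u d) (hδ : δ < d / 4)
    {a b : Fin n} (hab : b ≠ a) {z : ℂ} (hz : ‖z - (u a)⁻¹‖ ≤ δ) : 1 - u b * z ≠ 0 := by
  intro h0
  rw [h.eq_inv h0] at hz
  linarith [h.le_sub b a hab, h.pos]

theorem Separated.ne_zero_of_mem (h : Separated q s u d) (hR : 0 < R) (hδ : δ < d / 4)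
    {j : Option (Fin n)} {w : ℂ} (hw : ‖w - center u j‖ = radius R δ j) : w ≠ 0 := by
  cases j with
  | none =>
    simp only [center, radius, sub_zero] at hw
    exact norm_pos_iff.1 (hw ▸ hR)
  | some a => exact h.ne_zero_of_near_inv hδ hw.le

theorem Separated.one_sub_mul_ne_zero_of_mem (h : Separated q s u d) (hR : R < d / 4)
    (hδ0 : 0 < δ) (hδ : δ < d / 4) {j : Option (Fin n)} {w : ℂ}
    (hw : ‖w - center u j‖ = radius R δ j) (a : Fin n) : 1 - u a * w ≠ 0 := by
  cases j with
  | none =>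
    simp only [center, radius, sub_zero] at hw
    exact h.one_sub_mul_ne_zero_of_near_zero hR hw.le
  | some b =>
    rcases eq_or_ne a b with rfl | hab
    · intro h0
      simp only [center, radius] at hw
      rw [h.eq_inv h0, sub_self, norm_zero] at hw
      exact hδ0.ne hw
    · exact h.one_sub_mul_ne_zero_of_near_inv hδ hab hw.le

theorem Separated.sub_mul_ne_zero (h : Separated q s u d) (hR : R < d / 4) (hR' : R' < d / 4)
    (hδ : δ < d / 4) (hRR : R < ‖q‖ * R') {j j' : Option (Fin n)} {z w : ℂ}
    (hz : ‖z - center u j‖ ≤ radius R δ j) (hw : ‖w - center u j'‖ = radius R' δ j') :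
    z - q * w ≠ 0 := by
  intro h0
  replace h0 : z = q * w := sub_eq_zero.1 h0
  have hd := h.pos
  have hq := h.norm_le
  cases j with
  | none =>
    simp only [center, radius, sub_zero] at hz
    cases j' with
    | none =>
      simp only [center, radius, sub_zero] at hw
      rw [h0, norm_mul, hw] at hz
      linarith
    | some b =>
      simp only [center, radius] at hw
      have h1 : ‖q * w - q * (u b)⁻¹‖ ≤ δ := by
        rw [← mul_sub, norm_mul, hw]
        exact mul_le_of_le_one_left (hw ▸ norm_nonneg _) hq
      have h2 : ‖q * (u b)⁻¹‖ ≤ ‖q * w - q * (u b)⁻¹‖ + ‖z‖ := by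
        rw [h0, norm_sub_rev]
        simpa using norm_add_le (q * (u b)⁻¹ - q * w) (q * w)
      linarith [h.le_mul_inv b]
  | some a =>
    simp only [center, radius] at hz
    cases j' with
    | none =>
      simp only [center, radius, sub_zero] at hw
      have h1 : ‖z‖ ≤ R' := by
        rw [h0, norm_mul, hw]
        exact mul_le_of_le_one_left (hw ▸ norm_nonneg _) hq
      have h2 : ‖(u a)⁻¹‖ ≤ ‖z - (u a)⁻¹‖ + ‖z‖ := by
        rw [norm_sub_rev]
        simpa using norm_add_le ((u a)⁻¹ - z) z
      linarith [h.le_inv a]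
    | some b =>
      simp only [center, radius] at hw
      have h1 : ‖q * w - q * (u b)⁻¹‖ ≤ δ := by
        rw [← mul_sub, norm_mul, hw]
        exact mul_le_of_le_one_left (hw ▸ norm_nonneg _) hq
      have h2 : ‖(u a)⁻¹ - q * (u b)⁻¹‖ ≤ ‖z - (u a)⁻¹‖ + ‖q * w - q * (u b)⁻¹‖ := by
        rw [norm_sub_rev z, ← h0]
        simpa using norm_add_le ((u a)⁻¹ - z) (z - q * (u b)⁻¹)
      linarith [h.le_sub_mul a b]

theorem Separated.one_sub_mul_mul_ne_zero (h : Separated q s u d) (hR' : R' < d / 4)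
    (hδ0 : 0 < δ) (hδ : δ < d / 4) {j : Option (Fin n)} {w : ℂ}
    (hw : ‖w - center u j‖ = radius R' δ j) (a : Fin n) : 1 - q * u a * w ≠ 0 := by
  intro h0
  have hz : q * w = (u a)⁻¹ := h.eq_inv (by linear_combination h0)
  have hd := h.pos
  have hq := h.norm_le
  cases j with
  | none =>
    simp only [center, radius, sub_zero] at hw
    have h1 : ‖q * w‖ ≤ R' := by
      rw [norm_mul, hw]
      exact mul_le_of_le_one_left (hw ▸ norm_nonneg _) hq
    rw [hz] at h1
    linarith [h.le_inv a]
  | some b =>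
    simp only [center, radius] at hw
    have h1 : ‖q * w - q * (u b)⁻¹‖ ≤ δ := by
      rw [← mul_sub, norm_mul, hw]
      exact mul_le_of_le_one_left (hw ▸ norm_nonneg _) hq
    rw [hz] at h1
    linarith [h.le_sub_mul a b]

theorem norm_circleMap_sub_center {R : ℝ} (hR : 0 < R) (hδ : 0 < δ) (j : Option (Fin n)) (θ : ℝ) :
    ‖circleMap (center u j) (radius R δ j) θ - center u j‖ = radius R δ j := by
  have := circleMap_mem_sphere (center u j) (radius_pos hR hδ j).le θ
  rwa [mem_sphere_iff_norm] at this

theorem Separated.continuousAlong (h : Separated q s u d) (hδ0 : 0 < δ) (hδ : δ < d / 4) (y : ℕ)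
    (A : Finset (Fin n)) {l : ℕ} {R : Fin l → ℝ} (hR0 : ∀ i, 0 < R i) (hR : ∀ i, R i < d / 4)
    (hRR : ∀ i j, i < j → R i < ‖q‖ * R j) :
    ContinuousAlong (center u) (fun i => radius (R i) δ)
      fun _ : Unit => momentIntegrand q s u y A l := by
  intro j
  have hm : ∀ i (x : Unit × (Fin l → ℝ)), ‖circleMap (center u (j i)) (radius (R i) δ (j i)) (x.2 i) -
      center u (j i)‖ = radius (R i) δ (j i) :=
    fun i x => norm_circleMap_sub_center (hR0 i) hδ0 _ _
  refine continuous_momentIntegrand y A (fun i => by fun_prop) ?_ ?_ ?_ ?_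
  · exact fun i x => h.ne_zero_of_mem (hR0 i) hδ (hm i x)
  · exact fun i x => h.one_sub_inv_mul_ne_zero (hR i) hδ (hm i x).le
  · exact fun i x a => h.one_sub_mul_ne_zero_of_mem (hR i) hδ0 hδ (hm i x) a
  · exact fun i i' x hi => h.sub_mul_ne_zero (hR i) (hR i') hδ (hRR i i' hi) (hm i x).le (hm i' x)

theorem Separated.circleIntegral_none (h : Separated q s u d) (hq0 : q ≠ 0) (hδ : δ < d / 4) (y : ℕ)
    (A : Finset (Fin n)) {l : ℕ} {R : Fin (l + 1) → ℝ} (hR0 : ∀ i, 0 < R i)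
    (hR : ∀ i, R i < d / 4) (hRR : ∀ i j, i < j → R i < ‖q‖ * R j) {w : Fin l → ℂ}
    {j : Fin l → Option (Fin n)} (hw : ∀ i, ‖w i - center u (j i)‖ = radius (R i.succ) δ (j i)) :
    ∮ z in C(center u none, radius (R 0) δ (none : Option (Fin n))),
        momentIntegrand q s u y A (l + 1) (Fin.cons z w) =
      2 * Real.pi * Complex.I * (q⁻¹) ^ l * momentIntegrand q s u y A l w := by
  have hz : ∀ z ∈ Metric.closedBall (0 : ℂ) (R 0), ‖z - center u none‖ ≤
      radius (R 0) δ (none : Option (Fin n)) := fun z hz => by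
    simpa only [center, radius] using mem_closedBall_iff_norm.1 hz
  exact circleIntegral_momentIntegrand_zero hq0 y (fun i => h.ne_zero_of_mem (hR0 _) hδ (hw i))
    (hR0 0)
    (fun z hzm i => h.sub_mul_ne_zero (hR 0) (hR i.succ) hδ (hRR 0 i.succ i.succ_pos) (hz z hzm)
      (hw i))
    (fun z hzm => h.one_sub_inv_mul_ne_zero (hR 0) hδ (hz z hzm))
    fun z hzm a _ => h.one_sub_mul_ne_zero_of_near_zero (hR 0) (mem_closedBall_zero_iff.1 hzm)

theorem Separated.circleIntegral_some (h : Separated q s u d) (hδ0 : 0 < δ) (hδ : δ < d / 4) (y : ℕ)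
    (A : Finset (Fin n)) {l : ℕ} {R : Fin (l + 1) → ℝ}
    (hR : ∀ i, R i < d / 4) (hRR : ∀ i j, i < j → R i < ‖q‖ * R j) {w : Fin l → ℂ}
    {j : Fin l → Option (Fin n)} (hw : ∀ i, ‖w i - center u (j i)‖ = radius (R i.succ) δ (j i))
    (a : Fin n) :
    ∮ z in C(center u (some a), radius (R 0) δ (some a)),
        momentIntegrand q s u y A (l + 1) (Fin.cons z w) =
      (if a ∈ A then 2 * Real.pi * Complex.I * (-(1 - q)) *
        (hop (s ^ 2) (fun a => s * u a) a ^ y * ∏ b ∈ A.erase a, pairFactor q u a b) else 0) *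
          momentIntegrand q s u y (A.erase a) l w := by
  have hz : ∀ z ∈ Metric.closedBall (u a)⁻¹ δ, ‖z - center u (some a)‖ ≤
      radius (R 0) δ (some a) := fun z hz => by
    simpa only [center, radius] using mem_closedBall_iff_norm.1 hz
  have hz' : ∀ z ∈ Metric.closedBall (u a)⁻¹ δ, ‖z - (u a)⁻¹‖ ≤ δ :=
    fun z hz => mem_closedBall_iff_norm.1 hz
  have c1 : ∀ z ∈ Metric.closedBall (u a)⁻¹ δ, z ≠ 0 :=
    fun z hzm => h.ne_zero_of_near_inv hδ (hz' z hzm)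
  have c2 : ∀ z ∈ Metric.closedBall (u a)⁻¹ δ, ∀ i, z - q * w i ≠ 0 := fun z hzm i =>
    h.sub_mul_ne_zero (hR 0) (hR i.succ) hδ (hRR 0 i.succ i.succ_pos) (hz z hzm) (hw i)
  have c3 : ∀ z ∈ Metric.closedBall (u a)⁻¹ δ, 1 - s⁻¹ * z ≠ 0 :=
    fun z hzm => h.one_sub_inv_mul_ne_zero (hR 0) hδ (hz z hzm)
  have c4 : ∀ z ∈ Metric.closedBall (u a)⁻¹ δ, ∀ b, b ≠ a → 1 - u b * z ≠ 0 :=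
    fun z hzm b hb => h.one_sub_mul_ne_zero_of_near_inv hδ hb (hz' z hzm)
  split_ifs with ha
  · exact circleIntegral_momentIntegrand_inv h.s_ne_zero y h.ne_zero ha
      (fun i => h.one_sub_mul_ne_zero_of_mem (hR _) hδ0 hδ (hw i) a)
      (fun i => h.one_sub_mul_mul_ne_zero (hR _) hδ0 hδ (hw i) a) hδ0 c1 c2 c3
      fun z hzm b hb => c4 z hzm b (ne_of_mem_erase hb)
  · rw [zero_mul]
    exact circleIntegral_momentIntegrand_of_notMem y hδ0 c1 c2 c3
      fun z hzm b hb => c4 z hzm b fun hba => ha (hba ▸ hb)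

/-- Integrating out the outermost variable. -/
theorem Separated.iterInt_momentIntegrand_succ (h : Separated q s u d) (hq0 : q ≠ 0) (hδ0 : 0 < δ)
    (hδ : δ < d / 4) (y : ℕ) (A : Finset (Fin n)) {l : ℕ} {R : Fin (l + 1) → ℝ}
    (hR0 : ∀ i, 0 < R i) (hR : ∀ i, R i < d / 4) (hRR : ∀ i j, i < j → R i < ‖q‖ * R j) :
    iterInt (l + 1) (fun i => contourInt (center u) (radius (R i) δ))
        (momentIntegrand q s u y A (l + 1)) =
      2 * Real.pi * Complex.I * ((q⁻¹) ^ l *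
        iterInt l (fun i => contourInt (center u) (radius (R i.succ) δ))
          (momentIntegrand q s u y A l) -
        (1 - q) * ∑ a ∈ A, hop (s ^ 2) (fun a => s * u a) a ^ y *
          (∏ b ∈ A.erase a, pairFactor q u a b) *
          iterInt l (fun i => contourInt (center u) (radius (R i.succ) δ))
            (momentIntegrand q s u y (A.erase a) l)) := by
  have hswap : ∀ j, ∮ z in C(center u j, radius (R 0) δ j),
      iterInt l (fun i => contourInt (center u) (radius (R i.succ) δ))
        (fun w => momentIntegrand q s u y A (l + 1) (Fin.cons z w)) =
      iterInt l (fun i => contourInt (center u) (radius (R i.succ) δ)) fun w =>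
        ∮ z in C(center u j, radius (R 0) δ j),
          momentIntegrand q s u y A (l + 1) (Fin.cons z w) := by
    intro j
    refine circleIntegral_iterInt _ (fun i => radius (R i.succ) δ) _ _
      (fun z w => momentIntegrand q s u y A (l + 1) (Fin.cons z w)) fun j' => ?_
    have hc : Continuous fun p : ℝ × (Fin l → ℝ) => ((((), p.1), p.2) : (Unit × ℝ) × (Fin l → ℝ)) := by
      fun_prop
    have hcons := ContinuousAlong.cons (R := fun i => radius (R i) δ)
      (h.continuousAlong hδ0 hδ y A hR0 hR hRR) j j'
    exact (hcons.comp hc).congr fun p => rfl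
  have hmem : ∀ (j : Fin l → Option (Fin n)) (θ : Fin l → ℝ) (i : Fin l),
      ‖circleMap (center u (j i)) (radius (R i.succ) δ (j i)) (θ i) - center u (j i)‖ =
        radius (R i.succ) δ (j i) :=
    fun j θ i => norm_circleMap_sub_center (hR0 _) hδ0 _ _
  have hnone : iterInt l (fun i => contourInt (center u) (radius (R i.succ) δ)) (fun w =>
      ∮ z in C(center u none, radius (R 0) δ (none : Option (Fin n))),
        momentIntegrand q s u y A (l + 1) (Fin.cons z w)) =
      2 * Real.pi * Complex.I * (q⁻¹) ^ l *
        iterInt l (fun i => contourInt (center u) (radius (R i.succ) δ))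
          (momentIntegrand q s u y A l) :=
    (iterInt_congr _ (fun i => radius (R i.succ) δ) fun j θ =>
      h.circleIntegral_none hq0 hδ y A hR0 hR hRR (hmem j θ)).trans
      (iterInt_const_mul _ (fun i => radius (R i.succ) δ) _ _)
  have hsome : ∀ a, iterInt l (fun i => contourInt (center u) (radius (R i.succ) δ)) (fun w =>
      ∮ z in C(center u (some a), radius (R 0) δ (some a)),
        momentIntegrand q s u y A (l + 1) (Fin.cons z w)) =
      (if a ∈ A then 2 * Real.pi * Complex.I * (-(1 - q)) *
        (hop (s ^ 2) (fun a => s * u a) a ^ y * ∏ b ∈ A.erase a, pairFactor q u a b) else 0) *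
        iterInt l (fun i => contourInt (center u) (radius (R i.succ) δ))
          (momentIntegrand q s u y (A.erase a) l) := fun a =>
    (iterInt_congr _ (fun i => radius (R i.succ) δ) fun j θ =>
      h.circleIntegral_some hδ0 hδ y A hR hRR (hmem j θ) a).trans
      (iterInt_const_mul _ (fun i => radius (R i.succ) δ) _ _)
  rw [iterInt, contourInt, sum_congr rfl fun j _ => hswap j, Fintype.sum_option, hnone,
    sum_congr rfl fun a _ => hsome a]
  simp only [ite_mul, zero_mul]
  rw [sum_ite_mem, univ_inter, mul_sub, mul_sum, mul_sum, eq_sub_iff_add_eq, add_assoc,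
    ← sum_add_distrib, sum_eq_zero fun a _ => by ring]
  ring

theorem Separated.heightGen_eq_iterInt (h : Separated q s u d) (hq0 : q ≠ 0)
    (hu : Function.Injective u) (h1 : ∀ a, s * u a ≠ 1)
    (hφ : ∀ a, ‖hop (s ^ 2) (fun a => s * u a) a‖ < 1) (hδ0 : 0 < δ) (hδ : δ < d / 4) (y : ℕ)
    (A : Finset (Fin n)) {l : ℕ} {R : Fin l → ℝ}
    (hR0 : ∀ i, 0 < R i) (hR : ∀ i, R i < d / 4) (hRR : ∀ i j, i < j → R i < ‖q‖ * R j) :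
    heightGen q (s ^ 2) (fun a => s * u a) (hop (s ^ 2) fun a => s * u a)
        (fun a => (1 - s * u a)⁻¹) y (q ^ l) A =
      q ^ (l * (l - 1) / 2) * (1 / (2 * (Real.pi : ℂ) * Complex.I)) ^ l *
        iterInt l (fun i => contourInt (center u) (radius (R i) δ))
          (momentIntegrand q s u y A l) := by
  have hz : Function.Injective fun a => s * u a :=
    fun a b h' => hu (mul_left_cancel₀ h.s_ne_zero h')
  have hz0 : ∀ a, s * u a ≠ 0 := fun a => mul_ne_zero h.s_ne_zero (h.ne_zero a)
  induction l generalizing A with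
  | zero =>
    rw [pow_zero, heightGen_one h.norm_le hz h1 hφ]
    simp [iterInt, momentIntegrand]
  | succ l ih =>
    have ih' := fun A => ih A (R := fun i => R i.succ) (fun i => hR0 _) (fun i => hR _)
      fun i j hij => hRR _ _ (Fin.succ_lt_succ_iff.2 hij)
    rw [pow_succ' q l, heightGen_mul h.norm_le hz h1 hz0 hφ,
      h.iterInt_momentIntegrand_succ hq0 hδ0 hδ y A hR0 hR hRR, ih']
    simp only [ih', pairFactor_mul_left h.s_ne_zero]
    have he : (l + 1) * (l + 1 - 1) / 2 = l * (l - 1) / 2 + l := by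
      rw [← Nat.choose_two_right, ← Nat.choose_two_right, Nat.choose_succ_succ' l 1,
        Nat.choose_one_right, add_comm]
    have hql : q ^ l * (q⁻¹) ^ l = 1 := by
      rw [← mul_pow, mul_inv_cancel₀ hq0, one_pow]
    have hpi : 1 / (2 * (Real.pi : ℂ) * Complex.I) * (2 * Real.pi * Complex.I) = 1 :=
      one_div_mul_cancel Complex.two_pi_I_ne_zero
    generalize (2 * (Real.pi : ℂ) * Complex.I) = P at hpi ⊢
    rw [he, pow_add, pow_succ (1 / P)]
    have hsum : ∀ K : ℂ, ∑ a ∈ A, hop (s ^ 2) (fun a => s * u a) a ^ y *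
        (∏ b ∈ A.erase a, pairFactor q u a b) * (K *
          iterInt l (fun i => contourInt (center u) (radius (R i.succ) δ))
            (momentIntegrand q s u y (A.erase a) l)) = K * ∑ a ∈ A,
        hop (s ^ 2) (fun a => s * u a) a ^ y * (∏ b ∈ A.erase a, pairFactor q u a b) *
          iterInt l (fun i => contourInt (center u) (radius (R i.succ) δ))
            (momentIntegrand q s u y (A.erase a) l) := by
      intro K
      rw [mul_sum]
      exact sum_congr rfl fun a _ => by ring
    rw [hsum]
    generalize (∑ a ∈ A, hop (s ^ 2) (fun a => s * u a) a ^ y *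
        (∏ b ∈ A.erase a, pairFactor q u a b) *
          iterInt l (fun i => contourInt (center u) (radius (R i.succ) δ))
            (momentIntegrand q s u y (A.erase a) l)) = S
    generalize iterInt l _ _ = T
    linear_combination (-q ^ (l * (l - 1) / 2) * (1 / P) ^ l * T) * hql -
      q ^ (l * (l - 1) / 2) * (1 / P) ^ l * q ^ l * (q⁻¹ ^ l * T - (1 - q) * S) * hpi

end Contours

theorem exists_pos_le {ι : Type*} [Finite ι] (f : ι → ℝ) (hf : ∀ i, 0 < f i) :
    ∃ d, 0 < d ∧ ∀ i, d ≤ f i := by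
  cases isEmpty_or_nonempty ι with
  | inl _ => exact ⟨1, one_pos, isEmptyElim⟩
  | inr _ =>
    obtain ⟨i, hi⟩ := Finite.exists_min f
    exact ⟨f i, hf i, hi⟩

theorem exists_separated {n : ℕ} {q s : ℂ} {u : Fin n → ℂ} (hq : ‖q‖ ≤ 1) (hq0 : q ≠ 0)
    (hs : s ≠ 0) (hu0 : ∀ a, u a ≠ 0) (hu : Function.Injective u) (huq : ∀ a b, u b ≠ q * u a)
    (hus : ∀ a, s * u a ≠ 1) : ∃ d, Separated q s u d := by
  obtain ⟨d₁, h₁, h₁'⟩ := exists_pos_le (fun a => ‖(u a)⁻¹‖)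
    fun a => norm_pos_iff.2 (inv_ne_zero (hu0 a))
  obtain ⟨d₂, h₂, h₂'⟩ := exists_pos_le (fun a => ‖q * (u a)⁻¹‖)
    fun a => norm_pos_iff.2 (mul_ne_zero hq0 (inv_ne_zero (hu0 a)))
  obtain ⟨d₃, h₃, h₃'⟩ := exists_pos_le
    (fun p : {p : Fin n × Fin n // p.1 ≠ p.2} => ‖(u p.1.1)⁻¹ - (u p.1.2)⁻¹‖)
    fun p => norm_pos_iff.2 (sub_ne_zero.2 fun h => p.2 (hu (inv_injective h)))
  obtain ⟨d₄, h₄, h₄'⟩ := exists_pos_le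
    (fun p : Fin n × Fin n => ‖(u p.1)⁻¹ - q * (u p.2)⁻¹‖)
    fun p => norm_pos_iff.2 (sub_ne_zero.2 fun h => huq p.1 p.2 (by
      have h1 := hu0 p.1
      have h2 := hu0 p.2
      field_simp at h
      linear_combination h))
  obtain ⟨d₅, h₅, h₅'⟩ := exists_pos_le (fun a => ‖(u a)⁻¹ - s‖)
    fun a => norm_pos_iff.2 (sub_ne_zero.2 fun h => hus a (by
      rw [← h, inv_mul_cancel₀ (hu0 a)]))
  have hs' := norm_pos_iff.2 hs
  refine ⟨min ‖s‖ (min d₁ (min d₂ (min d₃ (min d₄ d₅)))), by positivity, hq, ?_, fun a => ?_,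
    fun a => ?_, fun a b hab => ?_, fun a b => ?_, fun a => ?_⟩
  · exact min_le_left _ _
  · exact le_trans (by simp) (h₁' a)
  · exact le_trans (by simp) (h₂' a)
  · exact le_trans (by simp) (h₃' ⟨(a, b), hab⟩)
  · exact le_trans (by simp) (h₄' (a, b))
  · exact le_trans (by simp) (h₅' a)

theorem norm_hop_lt_one {s v : ℝ} (hs : s ∈ Set.Ioo (-1 : ℝ) 0) (hv : 0 < v) {n : ℕ}
    {u : Fin n → ℂ} {a : Fin n} (ha : u a = v) : ‖hop ((s : ℂ) ^ 2) (fun a => s * u a) a‖ < 1 := by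
  have h1 : hop ((s : ℂ) ^ 2) (fun a => s * u a) a = ((s ^ 2 - s * v) / (1 - s * v) : ℝ) := by
    rw [hop, ha]
    push_cast
    rfl
  have h2 : s * v < 0 := mul_neg_of_neg_of_pos hs.2 hv
  have h3 : s ^ 2 < 1 := by nlinarith [hs.1, hs.2]
  rw [h1, Complex.norm_real, Real.norm_eq_abs, abs_of_pos, div_lt_one] <;> [skip; skip; apply div_pos]
  all_goals nlinarith [sq_nonneg s]

/-- Proposition 9.5: the one-point q-moments of the height function of the stochastic higher
spin six vertex model started from the empty configuration, with the contours `γ[ū|j]` realized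
as small circles around the points `u_i⁻¹` together with a circle of radius `r^j·ρ` around `0`. -/
theorem one_point_q_moments (q s : ℝ) (hq : q ∈ Set.Ioo (0 : ℝ) 1)
    (hs : s ∈ Set.Ioo (-1 : ℝ) 0) (n : ℕ) (hn : 1 ≤ n) (u : Fin n → ℝ)
    (hupos : ∀ i, 0 < u i) (huinj : Function.Injective u)
    (huq : ∀ i j, u i ≠ q * u j) (r : ℝ) (hr : q⁻¹ < r)
    (l : ℕ) (hl : 1 ≤ l) (x : ℕ) (hx : 1 ≤ x) :
    ∃ δ₀ : ℝ, 0 < δ₀ ∧ ∃ ρ₀ : ℝ, 0 < ρ₀ ∧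
      ∀ δ ∈ Set.Ioo (0 : ℝ) δ₀, ∀ ρ ∈ Set.Ioo (0 : ℝ) ρ₀,
      Summable (fun ν : Sign n =>
        Mwt (q : ℂ) (s : ℂ) (fun i => (u i : ℂ)) ν.1 * (q : ℂ) ^ (l * height ν.1 x)) ∧
      ∑' ν : Sign n,
          Mwt (q : ℂ) (s : ℂ) (fun i => (u i : ℂ)) ν.1 * (q : ℂ) ^ (l * height ν.1 x)
        = (q : ℂ) ^ (l * (l - 1) / 2) * (1 / (2 * (Real.pi : ℂ) * Complex.I)) ^ l *
            iterInt l
              (fun i => fun g =>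
                (∑ j, ∮ z in C(((u j : ℂ))⁻¹, δ), g z) +
                  ∮ z in C(0, r ^ ((i : ℕ) + 1) * ρ), g z)
              (fun w =>
                (∏ p ∈ (Finset.univ : Finset (Fin l × Fin l)).filter (fun p => p.1 < p.2),
                  (w p.1 - w p.2) / (w p.1 - (q : ℂ) * w p.2)) *
                ∏ i, ((w i)⁻¹ *
                  ((1 - (s : ℂ) * w i) / (1 - ((s : ℂ))⁻¹ * w i)) ^ (x - 1) *
                  ∏ j, (1 - (q : ℂ) * (u j : ℂ) * w i) / (1 - (u j : ℂ) * w i))) := by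
  obtain ⟨hq0, hq1⟩ := hq
  have hqn : ‖(q : ℂ)‖ = q := by rw [Complex.norm_real, Real.norm_of_nonneg hq0.le]
  have hs0 : (s : ℂ) ≠ 0 := Complex.ofReal_ne_zero.2 hs.2.ne
  have hqc : (q : ℂ) ≠ 0 := Complex.ofReal_ne_zero.2 hq0.ne'
  have hu : Function.Injective fun i => (u i : ℂ) := Complex.ofReal_injective.comp huinj
  have hu0 : ∀ i, (u i : ℂ) ≠ 0 := fun i => Complex.ofReal_ne_zero.2 (hupos i).ne'
  have hus : ∀ i, (s : ℂ) * u i ≠ 1 := fun i => by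
    have := mul_neg_of_neg_of_pos hs.2 (hupos i)
    exact_mod_cast (this.trans one_pos).ne
  have hφ : ∀ a, ‖hop ((s : ℂ) ^ 2) (fun a => s * (u a : ℂ)) a‖ < 1 :=
    fun a => norm_hop_lt_one (u := fun i => (u i : ℂ)) hs (hupos a) rfl
  obtain ⟨d, hd⟩ := exists_separated (hqn.le.trans hq1.le) hqc hs0 hu0 hu
    (fun a b => by exact_mod_cast huq b a) hus
  have hd4 : 0 < d / 4 := by linarith [hd.pos]
  have hqr : 1 < q * r := by rwa [inv_lt_iff_one_lt_mul₀' hq0] at hr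
  have hr1 : 1 < r := (one_lt_inv₀ hq0).2 hq1 |>.trans hr
  have hr0 : 0 < r := one_pos.trans hr1
  refine ⟨d / 4, hd4, d / 4 / r ^ l, by positivity, fun δ hδ ρ hρ => ?_⟩
  have hsum := hasSum_Mwt (hqn.trans_lt hq1) hs0 hu hu0 hφ x (Q := (q : ℂ) ^ l)
    (by rw [norm_pow, hqn]; exact pow_le_one₀ hq0.le hq1.le)
  simp only [← pow_mul] at hsum
  refine ⟨hsum.summable, hsum.tsum_eq.trans ?_⟩
  rw [hd.heightGen_eq_iterInt (R := fun i : Fin l => r ^ ((i : ℕ) + 1) * ρ) hqc hu hus hφ hδ.1 hδ.2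
    (x - 1) univ (fun i => mul_pos (pow_pos hr0 _) hρ.1) (fun i => ?_) fun i j hij => ?_]
  · congr 2
    funext i g
    rw [contourInt, Fintype.sum_option, add_comm]
    rfl
  · refine (mul_le_mul_of_nonneg_right (pow_le_pow_right₀ hr1.le i.2) hρ.1.le).trans_lt ?_
    rw [mul_comm]
    exact (lt_div_iff₀ (pow_pos hr0 l)).1 hρ.2
  · rw [hqn, ← mul_assoc]
    refine mul_lt_mul_of_pos_right ?_ hρ.1
    calc r ^ ((i : ℕ) + 1) < q * r * r ^ ((i : ℕ) + 1) :=
          lt_mul_of_one_lt_left (pow_pos hr0 _) hqr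
      _ = q * r ^ ((i : ℕ) + 2) := by ring
      _ ≤ q * r ^ ((j : ℕ) + 1) := mul_le_mul_of_nonneg_left
          (pow_le_pow_right₀ hr1.le (Nat.succ_le_succ hij)) hq0.le

end
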